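/- arXiv:2203.09779 — 3 statements merged into one kernel-verified Lean document; each statement's English description precedes it below -/
import Mathlib

section
/- Let $d \ge 1$, $0 < \lambda < d$, and define $L_d(u) = e^{du/q} \int_{\mathbb{S}^{d-1}} |e^u e_1 - \omega|^{-\lambda} \, d\omega$ for $u \in \mathbb{R}$, where $1 < p, q < \infty$ satisfy $1/p + \lambda/d = 1 + 1/q$ and $e_1$ is a unit vector. Then $L_d \in L^1(\mathbb{R})$. -/
open MeasureTheory
open scoped ENNReal NNReal

lemma lieb_aux_ball {E : Type*} [NormedAddCommGroup E] [NormedSpace ℝ E] [Nontrivial E]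
    [FiniteDimensional ℝ E] [MeasurableSpace E] [BorelSpace E] (μ : Measure E)
    [μ.IsAddHaarMeasure] (s r : ℝ) (hr : 0 < r) (hs : s < Module.finrank ℝ E) :
    IntegrableOn (fun x : E => ‖x‖ ^ (-s)) (Metric.ball (0 : E) r) μ := by
  have hpos : 0 < Module.finrank ℝ E := Module.finrank_pos
  rw [integrableOn_fun_norm_addHaar μ (f := fun y : ℝ => y ^ (-s))]
  have h1 : IntegrableOn (fun y : ℝ => y ^ ((Module.finrank ℝ E : ℝ) - 1 - s)) (Set.Ioo 0 r) := by
    rw [intervalIntegral.integrableOn_Ioo_rpow_iff hr]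
    linarith
  refine h1.congr_fun ?_ measurableSet_Ioo
  intro y hy
  have hy0 : 0 < y := hy.1
  simp only [smul_eq_mul]
  rw [← Real.rpow_natCast, ← Real.rpow_add hy0, Nat.cast_sub hpos]
  congr 1
  push_cast
  ring

lemma lieb_aux_full {E : Type*} [NormedAddCommGroup E] [NormedSpace ℝ E] [Nontrivial E]
    [FiniteDimensional ℝ E] [MeasurableSpace E] [BorelSpace E] (μ : Measure E)
    [μ.IsAddHaarMeasure] (a b : ℝ) (_ha0 : 0 < a) (_hb0 : 0 < b) (ha : a < Module.finrank ℝ E)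
    (hb : b < Module.finrank ℝ E) (hab : (Module.finrank ℝ E : ℝ) < a + b)
    (e : E) (he : ‖e‖ = 1) :
    Integrable (fun x : E => ‖x‖ ^ (-a) * ‖x - e‖ ^ (-b)) μ := by
  have i1 : Integrable (fun x : E => (Metric.ball (0 : E) 2).indicator
      (fun x => ‖x‖ ^ (-a)) x) μ :=
    (lieb_aux_ball μ a 2 (by norm_num) ha).integrable_indicator measurableSet_ball
  have i2 : Integrable (fun x : E => (Metric.ball (0 : E) 2).indicator
      (fun x => ‖x‖ ^ (-b)) (x - e)) μ :=
    ((lieb_aux_ball μ b 2 (by norm_num) hb).integrable_indicator measurableSet_ball).comp_sub_right e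
  have i3 : Integrable (fun x : E => (1 + ‖x‖) ^ (-(a + b))) μ := integrable_one_add_norm hab
  have key := ((i1.const_mul ((1/2:ℝ) ^ (-b))).add (i2.const_mul ((1/2:ℝ) ^ (-a)))).add
    (i3.const_mul ((1/3:ℝ) ^ (-(a + b))))
  refine key.mono' ?_ ?_
  · apply Measurable.aestronglyMeasurable
    fun_prop
  · refine Filter.Eventually.of_forall fun x => ?_
    have hn : 0 ≤ ‖x‖ ^ (-a) * ‖x - e‖ ^ (-b) := by positivity
    rw [Real.norm_of_nonneg hn]
    simp only [Pi.add_apply]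
    have p1 : 0 ≤ (Metric.ball (0 : E) 2).indicator (fun x => ‖x‖ ^ (-a)) x :=
      Set.indicator_nonneg (fun _ _ => by positivity) _
    have p2 : 0 ≤ (Metric.ball (0 : E) 2).indicator (fun x => ‖x‖ ^ (-b)) (x - e) :=
      Set.indicator_nonneg (fun _ _ => by positivity) _
    have p1' := mul_nonneg (show 0 ≤ (1/2:ℝ) ^ (-b) by positivity) p1
    have p2' := mul_nonneg (show 0 ≤ (1/2:ℝ) ^ (-a) by positivity) p2
    have p3' : 0 ≤ (1/3:ℝ) ^ (-(a + b)) * (1 + ‖x‖) ^ (-(a + b)) := by positivity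
    have t1 : ‖x‖ ≤ ‖x - e‖ + 1 := by
      have := norm_add_le (x - e) e
      rwa [sub_add_cancel, he] at this
    have t2 : 1 ≤ ‖x - e‖ + ‖x‖ := by
      have := norm_sub_le x (x - e)
      rw [sub_sub_cancel, he] at this
      linarith
    by_cases h2 : ‖x‖ < 2
    · by_cases hh : 1/2 ≤ ‖x - e‖
      · have : ‖x‖ ^ (-a) * ‖x - e‖ ^ (-b) ≤ (1/2:ℝ) ^ (-b) *
            (Metric.ball (0 : E) 2).indicator (fun x => ‖x‖ ^ (-a)) x := by
          rw [Set.indicator_of_mem (by simpa using h2), mul_comm]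
          gcongr ?_ * _
          exact Real.rpow_le_rpow_of_nonpos (by norm_num) hh (by linarith)
        linarith
      · push Not at hh
        have : ‖x‖ ^ (-a) * ‖x - e‖ ^ (-b) ≤ (1/2:ℝ) ^ (-a) *
            (Metric.ball (0 : E) 2).indicator (fun x => ‖x‖ ^ (-b)) (x - e) := by
          rw [Set.indicator_of_mem (by rw [mem_ball_zero_iff]; linarith)]
          gcongr ?_ * _
          exact Real.rpow_le_rpow_of_nonpos (by norm_num) (by linarith) (by linarith)
        linarith
    · push Not at h2
      have : ‖x‖ ^ (-a) * ‖x - e‖ ^ (-b) ≤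
          (1/3:ℝ) ^ (-(a + b)) * (1 + ‖x‖) ^ (-(a + b)) := by
        rw [← Real.mul_rpow (by norm_num) (by positivity), neg_add, Real.rpow_add (by positivity)]
        gcongr ?_ * ?_
        · exact Real.rpow_le_rpow_of_nonpos (by positivity) (by linarith) (by linarith)
        · exact Real.rpow_le_rpow_of_nonpos (by positivity) (by linarith) (by linarith)
      linarith

lemma lieb_aux_polar {E : Type*} [NormedAddCommGroup E] [NormedSpace ℝ E] [Nontrivial E]
    [FiniteDimensional ℝ E] [MeasurableSpace E] [BorelSpace E] (μ : Measure E)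
    [μ.IsAddHaarMeasure] (F : E → ℝ) (hF : Integrable F μ) :
    IntegrableOn (fun r : ℝ => r ^ (Module.finrank ℝ E - 1) *
      ∫ ω : Metric.sphere (0 : E) 1, F (r • (ω : E)) ∂μ.toSphere) (Set.Ioi 0) := by
  have h0 : Integrable (fun x : ({0}ᶜ : Set E) => F x) (μ.comap (↑)) := by
    exact (integrableOn_iff_comap_subtypeVal (by measurability)).1
      (hF.integrableOn (s := ({0}ᶜ : Set E)))
  have h1 : Integrable (fun z : Metric.sphere (0 : E) 1 × Set.Ioi (0 : ℝ) =>
      F (z.2.1 • (z.1 : E))) (μ.toSphere.prod (Measure.volumeIoiPow (Module.finrank ℝ E - 1))) := by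
    rw [← μ.measurePreserving_homeomorphUnitSphereProd.integrable_comp_emb
      (Homeomorph.measurableEmbedding _)]
    refine h0.congr (Filter.Eventually.of_forall fun x => ?_)
    have hx : ‖(x : E)‖ ≠ 0 := norm_ne_zero_iff.2 x.2
    simp [smul_smul, hx]
  have h2 := h1.integral_prod_right
  rw [Measure.volumeIoiPow, integrable_withDensity_iff_integrable_smul' (by fun_prop)
    (by simp)] at h2
  rw [integrableOn_iff_comap_subtypeVal measurableSet_Ioi]
  refine h2.congr (Filter.Eventually.of_forall ?_)
  rintro ⟨x, hx : 0 < x⟩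
  simp (disch := positivity) [ENNReal.toReal_ofReal]

/-- Integrability of the kernel `L_d(u) = e^{du/q} ∫_{𝕊^{d-1}} |e^u e₁ - ω|^{-λ} dω`
appearing in Lieb's proof of the refined Hardy–Littlewood–Sobolev inequality, where
`1/p + λ/d = 1 + 1/q` with `1 < p, q < ∞`. -/
theorem lieb_kernel_integrable (d : ℕ) (hd : 1 ≤ d) (lam p q : ℝ)
    (hlam0 : 0 < lam) (hlamd : lam < d) (hp : 1 < p) (hq : 1 < q)
    (hscal : 1 / p + lam / d = 1 + 1 / q)
    (e₁ : EuclideanSpace ℝ (Fin d)) (he₁ : ‖e₁‖ = 1) :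
    Integrable
      (fun u : ℝ => Real.exp (d * u / q) *
        ∫ ω : Metric.sphere (0 : EuclideanSpace ℝ (Fin d)) 1,
          ‖Real.exp u • e₁ - (ω : EuclideanSpace ℝ (Fin d))‖ ^ (-lam)
          ∂((volume : Measure (EuclideanSpace ℝ (Fin d))).toSphere))
      volume := by
  have hd0 : (0 : ℝ) < d := by exact_mod_cast hd
  have hdq : 0 < d / q := by positivity
  have hlt : d / q < lam := by
    have h1 : 1 / p < 1 := by rw [div_lt_one (by linarith)]; exact hp
    have h2 : 1 / q < lam / d := by linarith
    rw [lt_div_iff₀ hd0] at h2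
    calc d / q = 1 / q * d := by ring
      _ < lam := h2
  have hfr : Module.finrank ℝ (EuclideanSpace ℝ (Fin d)) = d := by simp
  have : Nontrivial (EuclideanSpace ℝ (Fin d)) :=
    ⟨⟨e₁, 0, fun h => by simp [h] at he₁⟩⟩
  have hF := lieb_aux_full (volume : Measure (EuclideanSpace ℝ (Fin d))) (d - lam + d / q) lam
    (by linarith) hlam0 (by rw [hfr]; linarith) (by rw [hfr]; exact hlamd)
    (by rw [hfr]; linarith) e₁ he₁
  have hG := lieb_aux_polar _ _ hF
  rw [hfr] at hG
  have himg : (fun u : ℝ => Real.exp (-u)) '' Set.univ = Set.Ioi 0 := by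
    ext y
    simp only [Set.image_univ, Set.mem_range, Set.mem_Ioi]
    constructor
    · rintro ⟨u, rfl⟩
      positivity
    · intro hy
      exact ⟨-Real.log y, by simp [Real.exp_log hy]⟩
  rw [← himg, integrableOn_image_iff_integrableOn_abs_deriv_smul MeasurableSet.univ
    (f' := fun u => -Real.exp (-u))
    (fun u _ => by
      have := (hasDerivAt_neg u).exp
      simpa using this)
    (fun x _ y _ h => by simpa using h), integrableOn_univ] at hG
  refine hG.congr (Filter.Eventually.of_forall fun u => ?_)
  simp only [smul_eq_mul, abs_neg, abs_of_pos (Real.exp_pos _)]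
  rw [← integral_const_mul, ← integral_const_mul, ← integral_const_mul]
  refine integral_congr_ae (Filter.Eventually.of_forall fun ω => ?_)
  have hω : ‖(ω : EuclideanSpace ℝ (Fin d))‖ = 1 := by simp
  have e1 : ‖Real.exp (-u) • (ω : EuclideanSpace ℝ (Fin d)) - e₁‖ =
      Real.exp (-u) * ‖Real.exp u • e₁ - (ω : EuclideanSpace ℝ (Fin d))‖ := by
    rw [norm_sub_rev (Real.exp u • e₁), ← abs_of_pos (Real.exp_pos (-u)), ← Real.norm_eq_abs,
      ← norm_smul, smul_sub, smul_smul, Real.norm_eq_abs, abs_of_pos (Real.exp_pos (-u)),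
      ← Real.exp_add]
    simp
  simp only [e1, norm_smul, hω, mul_one, Real.norm_eq_abs, abs_of_pos (Real.exp_pos _)]
  rw [Real.mul_rpow (Real.exp_pos _).le (norm_nonneg _), ← Real.exp_mul, ← Real.exp_mul,
    ← Real.exp_nat_mul, ← mul_assoc, ← mul_assoc, ← mul_assoc, ← Real.exp_add, ← Real.exp_add,
    ← Real.exp_add]
  congr 2
  rw [Nat.cast_sub hd]
  push_cast
  ring
end

section
/- Let $d \ge 1$, $s \in (0, d/2)$, $q = 2d/(d-2s)$, and let $\chi : [0,\infty) \to [0,1]$ be measurable with $1 - \chi$ vanishing near $0$ and $\chi$ compactly supported, such that $\int_0^\infty (1-\chi(b))^2 b^{-s-1} db < \infty$. Then, with $\theta = 1 - 2/q \in (0,1)$, there exists $C > 0$ such that for all $u \in \dot{H}^s(\mathbb{R}^d)$, $\|u\|_{L^q} \le C \big( \sup_{t>0} t^{(d-2s)/4} \|\chi(-t\Delta)u\|_{L^\infty} \big)^{\theta} \|u\|_{\dot{H}^s}^{1-\theta}$. -/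
open MeasureTheory Filter
open scoped ENNReal NNReal FourierTransform

lemma rs_fourierInv_continuous {d : ℕ} {w : EuclideanSpace ℝ (Fin d) → ℂ} (hw : Integrable w) :
    Continuous (𝓕⁻ w) := by
  apply VectorFourier.fourierIntegral_continuous (L := -innerₗ (EuclideanSpace ℝ (Fin d)))
    Real.continuous_fourierChar _ hw
  simp only [LinearMap.neg_apply, innerₗ_apply_apply]
  exact continuous_inner.neg

lemma rs_selfadj {d : ℕ} {f w : EuclideanSpace ℝ (Fin d) → ℂ} (hf : Integrable f)
    (hw : Integrable w) : ∫ x, 𝓕⁻ f x • w x = ∫ x, f x • 𝓕⁻ w x := by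
  have := VectorFourier.integral_fourierIntegral_smul_eq_flip
    (L := -innerₗ (EuclideanSpace ℝ (Fin d))) (μ := volume) (ν := volume)
    Real.continuous_fourierChar (by
      simp only [LinearMap.neg_apply, innerₗ_apply_apply]
      exact continuous_inner.neg) hf hw
  have h2 : (-innerₗ (EuclideanSpace ℝ (Fin d))).flip = -innerₗ (EuclideanSpace ℝ (Fin d)) := by
    ext x y
    simp [real_inner_comm]
  rw [h2] at this
  exact this

lemma rs_plancherel {d : ℕ} {w : EuclideanSpace ℝ (Fin d) → ℂ} (hw : Integrable w)
    (hw2 : MemLp w 2 volume) : eLpNorm (𝓕⁻ w) 2 volume = eLpNorm w 2 volume := by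
  set W := hw2.toLp w with hW
  set G : Lp (α := EuclideanSpace ℝ (Fin d)) ℂ 2 volume := 𝓕⁻ W with hG
  have key : ∀ᵐ x, (𝓕⁻ w) x = G x := by
    apply ae_eq_of_integral_contDiff_smul_eq
    · exact (rs_fourierInv_continuous hw).locallyIntegrable
    · exact (Lp.memLp G).locallyIntegrable (by norm_num)
    · intro g g_smooth g_cpt
      have hg₁ : HasCompactSupport (Complex.ofRealCLM ∘ g) := g_cpt.comp_left rfl
      have hg₂ : ContDiff ℝ (⊤ : ℕ∞) (Complex.ofRealCLM ∘ g) := by fun_prop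
      set φ := hg₁.toSchwartzMap hg₂ with hφ
      have e1 : ∫ x, g x • G x = (G : TemperedDistribution _ ℂ) φ := by
        rw [Lp.toTemperedDistribution_apply]
        simp [hφ]
      have e2 : ∫ x, g x • 𝓕⁻ w x = ∫ x, φ x • 𝓕⁻ w x := by
        simp [hφ]
      rw [e1, e2, hG, ← Lp.fourierInv_toTemperedDistribution_eq,
        TemperedDistribution.fourierInv_apply, Lp.toTemperedDistribution_apply,
        ← rs_selfadj φ.integrable hw]
      apply integral_congr_ae
      filter_upwards [hw2.coeFn_toLp] with x hx
      rw [hx, SchwartzMap.fourierInv_coe]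
  rw [eLpNorm_congr_ae key]
  have h1 : ‖G‖ = ‖W‖ := (Lp.fourierTransformₗᵢ (EuclideanSpace ℝ (Fin d)) ℂ).symm.norm_map W
  have h2 : ‖G‖ₑ = ‖W‖ₑ := by rw [← ofReal_norm, ← ofReal_norm, h1]
  rw [Lp.enorm_def, Lp.enorm_def] at h2
  rw [h2]
  exact eLpNorm_congr_ae hw2.coeFn_toLp

lemma rs_plancherel_le {d : ℕ} {w : EuclideanSpace ℝ (Fin d) → ℂ} (hw : Integrable w) :
    eLpNorm (𝓕⁻ w) 2 volume ≤ eLpNorm w 2 volume := by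
  by_cases h : eLpNorm w 2 volume = ⊤
  · rw [h]; exact le_top
  · exact (rs_plancherel hw ⟨hw.1, lt_top_iff_ne_top.2 h⟩).le
lemma rs_ball {d : ℕ} (hd : 1 ≤ d) {s : ℝ} (hsd : s < d / 2) :
    ∃ K : ℝ, 0 ≤ K ∧ ∀ r : ℝ, 0 < r →
      ∫⁻ ξ in Metric.ball (0 : EuclideanSpace ℝ (Fin d)) r, ENNReal.ofReal (‖ξ‖ ^ (-(2 * s)))
        = ENNReal.ofReal (K * r ^ (d - 2 * s)) := by
  have hfr : Module.finrank ℝ (EuclideanSpace ℝ (Fin d)) = d := by simp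
  have hint : ∀ r : ℝ, IntegrableOn (fun ξ : EuclideanSpace ℝ (Fin d) => ‖ξ‖ ^ (-(2 * s)))
      (Metric.ball 0 r) := by
    intro r
    apply integrableOn_ball_of_norm_le_rpow (C := 1) (α := 2 * s) (by rw [hfr]; exact hd)
    · rw [hfr]; linarith
    · refine Eventually.of_forall fun x => ?_
      rw [one_mul, Real.norm_of_nonneg (by positivity)]
    · exact (measurable_norm.pow_const _).aestronglyMeasurable
  refine ⟨∫ ξ in Metric.ball (0 : EuclideanSpace ℝ (Fin d)) 1, ‖ξ‖ ^ (-(2 * s)),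
    integral_nonneg fun _ => by positivity, fun r hr => ?_⟩
  rw [← ofReal_integral_eq_lintegral_ofReal (hint r) (Eventually.of_forall fun _ => by positivity)]
  congr 1
  rw [← integral_indicator Metric.isOpen_ball.measurableSet,
    ← integral_indicator Metric.isOpen_ball.measurableSet]
  have h := Measure.integral_comp_inv_smul (volume : Measure (EuclideanSpace ℝ (Fin d)))
    ((Metric.ball (0 : EuclideanSpace ℝ (Fin d)) 1).indicator fun ξ => ‖ξ‖ ^ (-(2 * s))) r
  have h2 : ∀ ξ : EuclideanSpace ℝ (Fin d),
      (Metric.ball (0 : EuclideanSpace ℝ (Fin d)) r).indicator (fun ξ => ‖ξ‖ ^ (-(2 * s))) ξ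
      = r ^ (-(2 * s)) *
      (Metric.ball (0 : EuclideanSpace ℝ (Fin d)) 1).indicator (fun ξ => ‖ξ‖ ^ (-(2 * s)))
        (r⁻¹ • ξ) := by
    intro ξ
    have hn : ‖r⁻¹ • ξ‖ = r⁻¹ * ‖ξ‖ := by
      rw [norm_smul, Real.norm_of_nonneg (by positivity)]
    by_cases hx : ‖ξ‖ < r
    · have hx' : ‖r⁻¹ • ξ‖ < 1 := by
        rw [hn, inv_mul_lt_iff₀ hr]; simpa using hx
      rw [Set.indicator_of_mem (by simpa using hx), Set.indicator_of_mem (by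
        rw [mem_ball_zero_iff]; exact hx'), hn, ← Real.mul_rpow hr.le (by positivity)]
      congr 1
      field_simp
    · have hx' : ¬ ‖r⁻¹ • ξ‖ < 1 := by
        rw [hn, inv_mul_lt_iff₀ hr]; simpa using hx
      rw [Set.indicator_of_notMem (by simpa using hx), Set.indicator_of_notMem (by
        rw [mem_ball_zero_iff]; exact hx'), mul_zero]
  simp_rw [h2]
  rw [integral_const_mul, h, hfr, abs_of_pos (by positivity), smul_eq_mul, ← mul_assoc,
    ← Real.rpow_natCast r d, ← Real.rpow_add hr, mul_comm]
  congr 2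
  ring

lemma rs_inner {s q γ A ρ : ℝ} (hγ : 0 < γ) (hγq : γ * (q - 2) = s)
    (χ : ℝ → ℝ) (hχ0 : χ 0 = 1) (hA : 0 < A) (hρ : 0 ≤ ρ) :
    ∫⁻ a in Set.Ioi (0 : ℝ), ENNReal.ofReal (a ^ (q - 3)) *
        ENNReal.ofReal ((1 - χ ((2 * A / a) ^ (1 / γ) * ρ ^ 2)) ^ 2)
      ≤ ENNReal.ofReal (γ * (2 * A) ^ (q - 2) * ρ ^ (2 * s)) *
        ∫⁻ b in Set.Ioi (0 : ℝ), ENNReal.ofReal ((1 - χ b) ^ 2 * b ^ (-s - 1)) := by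
  rcases hρ.eq_or_lt with rfl | hρ
  · simp [hχ0]
  set c : ℝ := 2 * A * ρ ^ (2 * γ) with hc
  have hcpos : 0 < c := by positivity
  set f : ℝ → ℝ := fun b => c * b ^ (-γ) with hf
  have hinv : ∀ b : ℝ, 0 < b → (2 * A / f b) ^ (1 / γ) * ρ ^ 2 = b := by
    intro b hb
    have : 2 * A / f b = (b / ρ ^ 2) ^ γ := by
      rw [Real.div_rpow hb.le (by positivity), ← Real.rpow_natCast ρ 2, ← Real.rpow_mul hρ.le]
      simp only [hf, hc, Real.rpow_neg hb.le]
      push_cast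
      field_simp
    rw [this, ← Real.rpow_mul (by positivity), mul_one_div_cancel hγ.ne', Real.rpow_one]
    field_simp
  have himg : Set.Ioi (0 : ℝ) ⊆ f '' Set.Ioi 0 := by
    intro a ha
    have ha : 0 < a := ha
    refine ⟨(c / a) ^ (1 / γ), by simp only [Set.mem_Ioi]; positivity, ?_⟩
    simp only [hf]
    rw [← Real.rpow_mul (by positivity)]
    have : 1 / γ * -γ = -1 := by field_simp
    rw [this, Real.rpow_neg_one]
    field_simp
  refine (lintegral_mono_set himg).trans ?_
  rw [lintegral_image_eq_lintegral_abs_deriv_mul (f' := fun b => c * (-γ * b ^ (-γ - 1)))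
    measurableSet_Ioi]
  · rw [← lintegral_const_mul' _ _ ENNReal.ofReal_ne_top]
    refine (setLIntegral_congr_fun measurableSet_Ioi fun b hb => ?_).le
    have hb : 0 < b := hb
    rw [hinv b hb, ← ENNReal.ofReal_mul (by positivity), ← ENNReal.ofReal_mul (by positivity),
      ← ENNReal.ofReal_mul (by positivity)]
    congr 1
    have e1 : |c * (-γ * b ^ (-γ - 1))| = c * (γ * b ^ (-γ - 1)) := by
      rw [show c * (-γ * b ^ (-γ - 1)) = -(c * (γ * b ^ (-γ - 1))) by ring, abs_neg,
        abs_of_pos (by positivity)]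
    have e2 : f b ^ (q - 3) = c ^ (q - 3) * b ^ (-γ * (q - 3)) := by
      simp only [hf]
      rw [Real.mul_rpow hcpos.le (by positivity), ← Real.rpow_mul hb.le]
    have e3 : c ^ (q - 3) * c = (2 * A) ^ (q - 2) * ρ ^ (2 * s) := by
      rw [← Real.rpow_add_one hcpos.ne', show q - 3 + 1 = q - 2 by ring, hc,
        Real.mul_rpow (by positivity) (by positivity), ← Real.rpow_mul hρ.le]
      congr 2
      rw [← hγq]; ring
    have e4 : b ^ (-γ - 1) * b ^ (-γ * (q - 3)) = b ^ (-s - 1) := by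
      rw [← Real.rpow_add hb]
      congr 1
      rw [← hγq]; ring
    rw [e1, e2, mul_assoc γ, ← e3, ← e4]
    ring
  · intro b hb
    exact ((Real.hasDerivAt_rpow_const (Or.inl (ne_of_gt hb))).const_mul c).hasDerivWithinAt
  · intro x hx y hy hxy
    rw [← hinv x hx, ← hinv y hy, hxy]
lemma rs_eLpNorm_top_le {d : ℕ} (w : EuclideanSpace ℝ (Fin d) → ℂ) :
    eLpNorm (𝓕⁻ w) ⊤ volume ≤ ∫⁻ ξ, ‖w ξ‖ₑ := by
  rw [eLpNorm_exponent_top]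
  apply eLpNormEssSup_le_of_ae_enorm_bound
  refine Eventually.of_forall fun x => ?_
  rw [Real.fourierInv_eq]
  refine (enorm_integral_le_lintegral_enorm _).trans (lintegral_mono fun ξ => ?_)
  rw [← ofReal_norm, ← ofReal_norm, Circle.norm_smul]

lemma rs_bdd {d : ℕ} (hd : 1 ≤ d) {s : ℝ} (hsd : s < d / 2)
    (χ : ℝ → ℝ) (hχ01 : ∀ b : ℝ, 0 ≤ χ b ∧ χ b ≤ 1)
    (hχc : HasCompactSupport χ)
    {v : EuclideanSpace ℝ (Fin d) → ℂ} (hv : Integrable v)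
    (hN : (∫⁻ ξ : EuclideanSpace ℝ (Fin d),
          (‖ξ‖₊ : ℝ≥0∞) ^ (2 * s) * (‖v ξ‖₊ : ℝ≥0∞) ^ 2) ≠ ⊤) :
    BddAbove (Set.range fun t : {t : ℝ // 0 < t} =>
              (t : ℝ) ^ (((d : ℝ) - 2 * s) / 4) *
                (eLpNorm
                  (𝓕⁻ (fun ξ : EuclideanSpace ℝ (Fin d) =>
                    (χ ((t : ℝ) * ‖ξ‖ ^ 2) : ℂ) * v ξ)) ⊤ volume).toReal) := by
  have : Nonempty (Fin d) := ⟨⟨0, hd⟩⟩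
  obtain ⟨K, hK0, hK⟩ := rs_ball hd hsd
  obtain ⟨R, hRpos, hR⟩ : ∃ R : ℝ, 0 < R ∧ ∀ b, R ≤ b → χ b = 0 := by
    obtain ⟨R, hR⟩ := hχc.isCompact.isBounded.subset_ball (0 : ℝ)
    refine ⟨max R 1, by positivity, fun b hb => ?_⟩
    by_contra h
    have := hR (subset_tsupport χ h)
    rw [mem_ball_zero_iff, Real.norm_eq_abs] at this
    linarith [le_abs_self b, le_max_left R 1]
  set N := (∫⁻ ξ : EuclideanSpace ℝ (Fin d),
          (‖ξ‖₊ : ℝ≥0∞) ^ (2 * s) * (‖v ξ‖₊ : ℝ≥0∞) ^ 2) with hNdef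
  set γ := ((d : ℝ) - 2 * s) / 4 with hγ
  refine ⟨K ^ (1 / 2 : ℝ) * R ^ γ * (N ^ (1 / 2 : ℝ)).toReal, ?_⟩
  rintro _ ⟨⟨t, ht⟩, rfl⟩
  simp only
  set r := (R / t) ^ (1 / 2 : ℝ) with hr
  have hrpos : 0 < r := by positivity
  have hbound : eLpNorm (𝓕⁻ (fun ξ : EuclideanSpace ℝ (Fin d) =>
                    (χ (t * ‖ξ‖ ^ 2) : ℂ) * v ξ)) ⊤ volume ≤
      ENNReal.ofReal (K ^ (1 / 2 : ℝ) * (R / t) ^ γ) * N ^ (1 / 2 : ℝ) := by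
    calc _ ≤ ∫⁻ ξ, ‖(χ (t * ‖ξ‖ ^ 2) : ℂ) * v ξ‖ₑ := rs_eLpNorm_top_le _
      _ ≤ ∫⁻ ξ, (Metric.ball (0 : EuclideanSpace ℝ (Fin d)) r).indicator (fun ξ => ‖v ξ‖ₑ) ξ := by
        refine lintegral_mono fun ξ => ?_
        by_cases hx : ‖ξ‖ < r
        · rw [Set.indicator_of_mem (by simpa using hx), enorm_mul]
          refine mul_le_of_le_one_left' ?_
          rw [← ofReal_norm, Complex.norm_real, Real.norm_of_nonneg (hχ01 _).1]
          exact ENNReal.ofReal_le_one.2 (hχ01 _).2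
        · have : χ (t * ‖ξ‖ ^ 2) = 0 := by
            apply hR
            have h1 : r ^ 2 ≤ ‖ξ‖ ^ 2 := by gcongr; exact not_lt.1 hx
            rw [hr, ← Real.rpow_natCast, ← Real.rpow_mul (by positivity)] at h1
            norm_num at h1
            rw [div_le_iff₀ ht] at h1
            linarith
          simp [this]
      _ = ∫⁻ ξ in Metric.ball (0 : EuclideanSpace ℝ (Fin d)) r, ‖v ξ‖ₑ :=
        lintegral_indicator Metric.isOpen_ball.measurableSet _
      _ = ∫⁻ ξ in Metric.ball (0 : EuclideanSpace ℝ (Fin d)) r,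
            ((fun ξ : EuclideanSpace ℝ (Fin d) => ENNReal.ofReal (‖ξ‖ ^ (-s))) *
              (fun ξ : EuclideanSpace ℝ (Fin d) => ‖ξ‖ₑ ^ s * ‖v ξ‖ₑ) :
              EuclideanSpace ℝ (Fin d) → ℝ≥0∞) ξ := by
        apply lintegral_congr_ae
        have h0 : ∀ᵐ ξ : EuclideanSpace ℝ (Fin d), ξ ≠ 0 := by
          simp [ae_iff, measure_singleton]
        filter_upwards [ae_restrict_of_ae h0] with ξ hξ
        have hp : 0 < ‖ξ‖ := norm_pos_iff.2 hξ
        rw [Pi.mul_apply, ← mul_assoc, ← ofReal_norm (x := ξ), ENNReal.ofReal_rpow_of_pos hp,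
          ← ENNReal.ofReal_mul (by positivity), ← Real.rpow_add hp]
        simp
      _ ≤ (∫⁻ ξ in Metric.ball (0 : EuclideanSpace ℝ (Fin d)) r,
              ENNReal.ofReal (‖ξ‖ ^ (-s)) ^ (2 : ℝ)) ^ (1 / 2 : ℝ) *
          (∫⁻ ξ in Metric.ball (0 : EuclideanSpace ℝ (Fin d)) r,
              (‖ξ‖ₑ ^ s * ‖v ξ‖ₑ) ^ (2 : ℝ)) ^ (1 / 2 : ℝ) := by
        apply ENNReal.lintegral_mul_le_Lp_mul_Lq _ Real.HolderConjugate.two_two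
        · exact (measurable_norm.pow_const _).ennreal_ofReal.aemeasurable
        · exact (measurable_enorm.pow_const _).aemeasurable.mul hv.1.enorm.restrict
      _ ≤ (∫⁻ ξ in Metric.ball (0 : EuclideanSpace ℝ (Fin d)) r,
              ENNReal.ofReal (‖ξ‖ ^ (-(2 * s)))) ^ (1 / 2 : ℝ) * N ^ (1 / 2 : ℝ) := by
        gcongr
        · refine (ENNReal.ofReal_rpow_of_nonneg (by positivity) (by norm_num)).trans_le ?_
          rw [← Real.rpow_mul (by positivity)]
          exact le_of_eq (by congr 2; ring)
        · refine (setLIntegral_le_lintegral _ _).trans (lintegral_mono fun ξ => ?_)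
          simp only
          rw [ENNReal.mul_rpow_of_nonneg _ _ (by norm_num), ← ENNReal.rpow_mul, mul_comm s]
          simp [enorm_eq_nnnorm]
      _ = _ := by
        rw [hK r hrpos, ENNReal.ofReal_rpow_of_nonneg (by positivity) (by norm_num),
          Real.mul_rpow hK0 (by positivity), hr, ← Real.rpow_mul (by positivity),
          ← Real.rpow_mul (by positivity)]
        congr 4
        rw [hγ]; ring
  have hN2 : N ^ (1 / 2 : ℝ) ≠ ⊤ := ENNReal.rpow_ne_top_of_nonneg (by norm_num) hN
  have h3 := ENNReal.toReal_mono (ENNReal.mul_ne_top ENNReal.ofReal_ne_top hN2) hbound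
  rw [ENNReal.toReal_mul, ENNReal.toReal_ofReal (by positivity)] at h3
  calc _ ≤ t ^ γ * (K ^ (1 / 2 : ℝ) * (R / t) ^ γ * (N ^ (1 / 2 : ℝ)).toReal) := by gcongr
    _ = _ := by
      rw [Real.div_rpow hRpos.le ht.le]
      field_simp

lemma rs_level {d : ℕ} (χ : ℝ → ℝ) (hχmeas : Measurable χ) (hχ01 : ∀ b : ℝ, 0 ≤ χ b ∧ χ b ≤ 1)
    {v : EuclideanSpace ℝ (Fin d) → ℂ} (hv : Integrable v) {t a : ℝ} (ha : 0 < a)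
    (h : (eLpNorm (𝓕⁻ (fun ξ : EuclideanSpace ℝ (Fin d) =>
                    (χ (t * ‖ξ‖ ^ 2) : ℂ) * v ξ)) ⊤ volume).toReal ≤ a / 2) :
    volume {x | a < ‖𝓕⁻ v x‖} ≤ ENNReal.ofReal (4 * a ^ (-2 : ℝ)) *
      ∫⁻ ξ, ENNReal.ofReal ((1 - χ (t * ‖ξ‖ ^ 2)) ^ 2) * ‖v ξ‖ₑ ^ 2 := by
  set w1 : EuclideanSpace ℝ (Fin d) → ℂ := fun ξ => (χ (t * ‖ξ‖ ^ 2) : ℂ) * v ξ with hw1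
  set w2 : EuclideanSpace ℝ (Fin d) → ℂ := fun ξ => ((1 - χ (t * ‖ξ‖ ^ 2) : ℝ) : ℂ) * v ξ with hw2
  have hm : Measurable fun ξ : EuclideanSpace ℝ (Fin d) => χ (t * ‖ξ‖ ^ 2) :=
    hχmeas.comp (by fun_prop)
  have i1 : Integrable w1 := by
    apply hv.bdd_mul (c := 1)
    · exact (Complex.measurable_ofReal.comp hm).aestronglyMeasurable
    · refine Eventually.of_forall fun ξ => ?_
      rw [Complex.norm_real, Real.norm_of_nonneg (hχ01 _).1]
      exact (hχ01 _).2
  have i2 : Integrable w2 := by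
    apply hv.bdd_mul (c := 1)
    · exact (Complex.measurable_ofReal.comp (measurable_const.sub hm)).aestronglyMeasurable
    · refine Eventually.of_forall fun ξ => ?_
      rw [Complex.norm_real, Real.norm_of_nonneg (by linarith [(hχ01 (t * ‖ξ‖ ^ 2)).2])]
      linarith [(hχ01 (t * ‖ξ‖ ^ 2)).1]
  have hsum : ∀ x, 𝓕⁻ v x = 𝓕⁻ w1 x + 𝓕⁻ w2 x := by
    intro x
    have hvw : v = w1 + w2 := by
      ext ξ; simp only [hw1, hw2, Pi.add_apply]; push_cast; ring
    have := VectorFourier.fourierIntegral_add (L := -innerₗ (EuclideanSpace ℝ (Fin d)))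
      (μ := volume) Real.continuous_fourierChar (by
        simp only [LinearMap.neg_apply, innerₗ_apply_apply]
        exact continuous_inner.neg) i1 i2
    rw [← hvw] at this
    exact congrFun this x
  have hfin : eLpNorm (𝓕⁻ w1) ⊤ volume ≠ ⊤ :=
    ne_top_of_le_ne_top i1.2.ne (rs_eLpNorm_top_le w1)
  have hae : ∀ᵐ x, ‖𝓕⁻ w1 x‖ ≤ a / 2 := by
    filter_upwards [ae_le_eLpNormEssSup (f := 𝓕⁻ w1) (μ := volume)] with x hx
    rw [← eLpNorm_exponent_top] at hx
    have := ENNReal.toReal_mono hfin hx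
    rw [toReal_enorm] at this
    exact this.trans h
  have hsub : volume {x | a < ‖𝓕⁻ v x‖} ≤ volume {x | ENNReal.ofReal (a / 2) ≤ ‖𝓕⁻ w2 x‖ₑ} := by
    apply measure_mono_ae
    filter_upwards [hae] with x hx hx2
    have hx2 : a < ‖𝓕⁻ v x‖ := hx2
    change ENNReal.ofReal (a / 2) ≤ ‖𝓕⁻ w2 x‖ₑ
    rw [← ofReal_norm]
    apply ENNReal.ofReal_le_ofReal
    rw [hsum x] at hx2
    linarith [norm_add_le (𝓕⁻ w1 x) (𝓕⁻ w2 x)]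
  refine hsub.trans ((meas_ge_le_mul_pow_eLpNorm_enorm volume (p := 2) (by norm_num) (by norm_num)
    (rs_fourierInv_continuous i2).aestronglyMeasurable (by simpa using ha) (by simp)).trans ?_)
  have e1 : (ENNReal.ofReal (a / 2))⁻¹ ^ (2 : ℝ≥0∞).toReal = ENNReal.ofReal (4 * a ^ (-2 : ℝ)) := by
    rw [← ENNReal.ofReal_inv_of_pos (by positivity),
      ENNReal.ofReal_rpow_of_pos (by positivity)]
    congr 1
    rw [Real.rpow_neg ha.le]
    simp
    ring
  rw [e1]
  gcongr
  refine (ENNReal.rpow_le_rpow (rs_plancherel_le i2) (by simp)).trans ?_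
  rw [eLpNorm_eq_lintegral_rpow_enorm_toReal (by norm_num) (by norm_num), ← ENNReal.rpow_mul]
  simp only [ENNReal.toReal_ofNat, one_div, isUnit_iff_ne_zero, ne_eq, OfNat.ofNat_ne_zero,
    not_false_eq_true, IsUnit.inv_mul_cancel, ENNReal.rpow_one]
  refine lintegral_mono fun ξ => ?_
  simp only [hw2, enorm_mul]
  rw [ENNReal.mul_rpow_of_nonneg _ _ (by norm_num), ← ofReal_norm, Complex.norm_real,
    Real.norm_of_nonneg (by linarith [(hχ01 (t * ‖ξ‖ ^ 2)).2]), ENNReal.ofReal_pow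
    (by linarith [(hχ01 (t * ‖ξ‖ ^ 2)).2])]
  simp

lemma rs_main {d : ℕ} {s q γ : ℝ} (hq : 2 < q) (hγpos : 0 < γ) (hγq : γ * (q - 2) = s)
    (χ : ℝ → ℝ) (hχmeas : Measurable χ) (hχ01 : ∀ b : ℝ, 0 ≤ χ b ∧ χ b ≤ 1) (hχ0 : χ 0 = 1)
    (hχint : IntegrableOn (fun b : ℝ => (1 - χ b) ^ 2 * b ^ (-s - 1)) (Set.Ioi 0))
    {v : EuclideanSpace ℝ (Fin d) → ℂ} (hv : Integrable v) {A : ℝ} (hA : 0 < A)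
    (h : ∀ t : ℝ, 0 < t → t ^ γ * (eLpNorm (𝓕⁻ (fun ξ : EuclideanSpace ℝ (Fin d) =>
                    (χ (t * ‖ξ‖ ^ 2) : ℂ) * v ξ)) ⊤ volume).toReal ≤ A) :
    ∫⁻ x, ENNReal.ofReal (‖𝓕⁻ v x‖ ^ q) ≤
      ENNReal.ofReal (4 * q * γ * 2 ^ (q - 2) *
        (∫ b in Set.Ioi (0 : ℝ), (1 - χ b) ^ 2 * b ^ (-s - 1)) * A ^ (q - 2)) *
      ∫⁻ ξ : EuclideanSpace ℝ (Fin d),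
          (‖ξ‖₊ : ℝ≥0∞) ^ (2 * s) * (‖v ξ‖₊ : ℝ≥0∞) ^ 2 := by
  have hs : 0 < s := by rw [← hγq]; exact mul_pos hγpos (by linarith)
  have hnn : 0 ≤ᵐ[volume.restrict (Set.Ioi (0 : ℝ))]
      fun b : ℝ => (1 - χ b) ^ 2 * b ^ (-s - 1) := by
    filter_upwards [ae_restrict_mem measurableSet_Ioi] with b hb
    have hb : 0 < b := hb
    simp only [Pi.zero_apply]
    positivity
  have hI := ofReal_integral_eq_lintegral_ofReal hχint hnn
  have hInn := integral_nonneg_of_ae hnn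
  set I := ∫ b in Set.Ioi (0 : ℝ), (1 - χ b) ^ 2 * b ^ (-s - 1) with hIdef
  rw [lintegral_rpow_eq_lintegral_meas_lt_mul volume (Eventually.of_forall fun _ => norm_nonneg _)
    (rs_fourierInv_continuous hv).norm.aemeasurable (by linarith)]
  have step1 : ∫⁻ a in Set.Ioi (0 : ℝ), volume {x | a < ‖𝓕⁻ v x‖} * ENNReal.ofReal (a ^ (q - 1))
      ≤ ∫⁻ a in Set.Ioi (0 : ℝ), ∫⁻ ξ : EuclideanSpace ℝ (Fin d), 4 * (ENNReal.ofReal (a ^ (q - 3)) *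
        ENNReal.ofReal ((1 - χ ((2 * A / a) ^ (1 / γ) * ‖ξ‖ ^ 2)) ^ 2) * ‖v ξ‖ₑ ^ 2) := by
    refine setLIntegral_mono' measurableSet_Ioi fun a ha => ?_
    have ha : 0 < a := ha
    have hlev := rs_level χ hχmeas hχ01 hv (t := (2 * A / a) ^ (1 / γ)) ha (by
      have h1 := h ((2 * A / a) ^ (1 / γ)) (by positivity)
      rw [← Real.rpow_mul (by positivity), one_div_mul_cancel hγpos.ne', Real.rpow_one] at h1
      rw [← le_div_iff₀' (by positivity)] at h1
      refine h1.trans (le_of_eq ?_)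
      field_simp)
    refine (mul_le_mul_left hlev _).trans ?_
    rw [mul_right_comm, ← ENNReal.ofReal_mul (by positivity),
      ← lintegral_const_mul' _ _ ENNReal.ofReal_ne_top]
    refine lintegral_mono fun ξ => ?_
    rw [mul_assoc 4, ← Real.rpow_add ha, show (-2 : ℝ) + (q - 1) = q - 3 by ring,
      ENNReal.ofReal_mul (by norm_num)]
    simp [mul_assoc]
  have step2 : ∫⁻ a in Set.Ioi (0 : ℝ), ∫⁻ ξ : EuclideanSpace ℝ (Fin d),
        4 * (ENNReal.ofReal (a ^ (q - 3)) *
        ENNReal.ofReal ((1 - χ ((2 * A / a) ^ (1 / γ) * ‖ξ‖ ^ 2)) ^ 2) * ‖v ξ‖ₑ ^ 2)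
      = ∫⁻ ξ : EuclideanSpace ℝ (Fin d), ∫⁻ a in Set.Ioi (0 : ℝ),
        4 * (ENNReal.ofReal (a ^ (q - 3)) *
        ENNReal.ofReal ((1 - χ ((2 * A / a) ^ (1 / γ) * ‖ξ‖ ^ 2)) ^ 2) * ‖v ξ‖ₑ ^ 2) := by
    apply lintegral_lintegral_swap
    have hm1 : Measurable fun p : ℝ × EuclideanSpace ℝ (Fin d) =>
        ENNReal.ofReal (p.1 ^ (q - 3)) *
        ENNReal.ofReal ((1 - χ ((2 * A / p.1) ^ (1 / γ) * ‖p.2‖ ^ 2)) ^ 2) := by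
      have hm0 : Measurable fun p : ℝ × EuclideanSpace ℝ (Fin d) =>
          χ ((2 * A / p.1) ^ (1 / γ) * ‖p.2‖ ^ 2) := hχmeas.comp (by fun_prop)
      fun_prop
    have hm2 : AEMeasurable (fun p : ℝ × EuclideanSpace ℝ (Fin d) => ‖v p.2‖ₑ ^ 2)
        ((volume.restrict (Set.Ioi (0 : ℝ))).prod volume) :=
      (hv.1.enorm.pow_const 2).comp_snd
    exact (hm1.aemeasurable.mul hm2).const_mul 4
  have step3 : ∀ ξ : EuclideanSpace ℝ (Fin d), ∫⁻ a in Set.Ioi (0 : ℝ),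
        4 * (ENNReal.ofReal (a ^ (q - 3)) *
        ENNReal.ofReal ((1 - χ ((2 * A / a) ^ (1 / γ) * ‖ξ‖ ^ 2)) ^ 2) * ‖v ξ‖ₑ ^ 2)
      ≤ ENNReal.ofReal (4 * γ * 2 ^ (q - 2) * I * A ^ (q - 2)) *
        ((‖ξ‖₊ : ℝ≥0∞) ^ (2 * s) * (‖v ξ‖₊ : ℝ≥0∞) ^ 2) := by
    intro ξ
    rw [lintegral_const_mul' _ _ (by norm_num), lintegral_mul_const' _ _ (by simp)]
    refine (mul_le_mul_right (mul_le_mul_left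
      (rs_inner hγpos hγq χ hχ0 hA (norm_nonneg ξ)) _) _).trans (le_of_eq ?_)
    rw [← hI, ← enorm_eq_nnnorm, ← enorm_eq_nnnorm, ← ofReal_norm (x := ξ),
      ENNReal.ofReal_rpow_of_nonneg (norm_nonneg _) (by linarith), ← mul_assoc, ← mul_assoc,
      show (4 : ℝ≥0∞) = ENNReal.ofReal 4 by simp,
      ← ENNReal.ofReal_mul (by positivity), ← ENNReal.ofReal_mul (by positivity),
      ← mul_assoc (ENNReal.ofReal _) (ENNReal.ofReal _), ← ENNReal.ofReal_mul (by positivity), Real.mul_rpow (by norm_num) hA.le]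
    congr 2
    ring
  calc _ ≤ ENNReal.ofReal q * ∫⁻ ξ : EuclideanSpace ℝ (Fin d),
        ENNReal.ofReal (4 * γ * 2 ^ (q - 2) * I * A ^ (q - 2)) *
        ((‖ξ‖₊ : ℝ≥0∞) ^ (2 * s) * (‖v ξ‖₊ : ℝ≥0∞) ^ 2) := by
        gcongr
        exact (step1.trans_eq step2).trans (lintegral_mono step3)
    _ = _ := by
        rw [lintegral_const_mul' _ _ ENNReal.ofReal_ne_top, ← mul_assoc,
          ← ENNReal.ofReal_mul (by linarith)]
        congr 2
        ring

/-- **Refined Sobolev inequality** (Gérard–Meyer–Oru): for `0 < s < d/2`, `q = 2d/(d-2s)`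
and a cutoff `χ : [0,∞) → [0,1]` with `1 - χ` vanishing near `0`, compactly supported and
`∫₀^∞ (1-χ(b))² b^{-s-1} db < ∞`, one has
`‖u‖_{L^q} ≤ C (sup_{t>0} t^{(d-2s)/4} ‖χ(-tΔ)u‖_∞)^θ ‖u‖_{Ḣ^s}^{1-θ}` with `θ = 1 - 2/q`,
stated on the Fourier side with `u = 𝓕⁻v`. -/
theorem refined_sobolev (d : ℕ) (hd : 1 ≤ d) (s q θ : ℝ)
    (hs0 : 0 < s) (hsd : s < d / 2) (hq : q = 2 * d / (d - 2 * s)) (hθ : θ = 1 - 2 / q)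
    (χ : ℝ → ℝ) (hχmeas : Measurable χ)
    (hχ01 : ∀ b : ℝ, 0 ≤ χ b ∧ χ b ≤ 1)
    (hχone : ∃ b₀ > (0 : ℝ), ∀ b : ℝ, 0 ≤ b → b ≤ b₀ → χ b = 1)
    (hχc : HasCompactSupport χ)
    (hχint : IntegrableOn (fun b : ℝ => (1 - χ b) ^ 2 * b ^ (-s - 1)) (Set.Ioi 0)) :
    ∃ C > (0 : ℝ), ∀ v : EuclideanSpace ℝ (Fin d) → ℂ,
      (∫⁻ ξ : EuclideanSpace ℝ (Fin d),
          (‖ξ‖₊ : ℝ≥0∞) ^ (2 * s) * (‖v ξ‖₊ : ℝ≥0∞) ^ 2) ≠ ⊤ →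
      eLpNorm (𝓕⁻ v) (ENNReal.ofReal q) volume ≤
        ENNReal.ofReal C *
          ENNReal.ofReal
            (⨆ t : {t : ℝ // 0 < t},
              (t : ℝ) ^ (((d : ℝ) - 2 * s) / 4) *
                (eLpNorm
                  (𝓕⁻ (fun ξ : EuclideanSpace ℝ (Fin d) =>
                    (χ ((t : ℝ) * ‖ξ‖ ^ 2) : ℂ) * v ξ)) ⊤ volume).toReal) ^ θ *
          ((∫⁻ ξ : EuclideanSpace ℝ (Fin d),
              (‖ξ‖₊ : ℝ≥0∞) ^ (2 * s) * (‖v ξ‖₊ : ℝ≥0∞) ^ 2) ^ (2⁻¹ : ℝ)) ^ (1 - θ) := by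
  have hdpos : (0 : ℝ) < d - 2 * s := by linarith
  have hd0 : (0 : ℝ) < d := by linarith
  have hq2 : 2 < q := by
    rw [hq, lt_div_iff₀ hdpos]; linarith
  have hq0 : 0 < q := by linarith
  have hγpos : 0 < ((d : ℝ) - 2 * s) / 4 := by positivity
  have hγq : ((d : ℝ) - 2 * s) / 4 * (q - 2) = s := by
    rw [hq]; field_simp; ring
  obtain ⟨b₀, hb₀, hone⟩ := hχone
  have hχ0 : χ 0 = 1 := hone 0 le_rfl hb₀.le
  set γ := ((d : ℝ) - 2 * s) / 4 with hγ
  set I := ∫ b in Set.Ioi (0 : ℝ), (1 - χ b) ^ 2 * b ^ (-s - 1) with hI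
  have hInn : 0 ≤ I := by
    apply setIntegral_nonneg measurableSet_Ioi
    intro b hb
    have hb : 0 < b := hb
    positivity
  set C₀ := 4 * q * γ * 2 ^ (q - 2) * I with hC₀
  have hC₀nn : 0 ≤ C₀ := by positivity
  have hθ0 : 0 < θ := by
    rw [hθ, sub_pos, div_lt_one hq0]; exact hq2
  have hθ1 : 1 - θ = 2 / q := by rw [hθ]; ring
  refine ⟨C₀ ^ (1 / q) + 1, by positivity, fun v hN => ?_⟩
  by_cases hv : Integrable v
  swap
  · have : 𝓕⁻ v = 0 := by
      ext x
      rw [Real.fourierInv_eq]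
      apply integral_undef
      intro hc
      apply hv
      have := (Real.fourierIntegral_convergent_iff (f := v) (μ := volume) (-x)).1
        (by simpa using hc)
      exact this
    rw [this]
    simp
  have hb := rs_bdd hd hsd χ hχ01 hχc hv hN
  set S := ⨆ t : {t : ℝ // 0 < t}, (t : ℝ) ^ γ * (eLpNorm
                  (𝓕⁻ (fun ξ : EuclideanSpace ℝ (Fin d) =>
                    (χ ((t : ℝ) * ‖ξ‖ ^ 2) : ℂ) * v ξ)) ⊤ volume).toReal with hS
  set N := ∫⁻ ξ : EuclideanSpace ℝ (Fin d),
          (‖ξ‖₊ : ℝ≥0∞) ^ (2 * s) * (‖v ξ‖₊ : ℝ≥0∞) ^ 2 with hNdef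
  have hS0 : 0 ≤ S := Real.iSup_nonneg fun t => by have := t.2; positivity
  have hM : (N ^ (2⁻¹ : ℝ)) ^ (1 - θ) ≠ ⊤ :=
    ENNReal.rpow_ne_top_of_nonneg (by rw [hθ1]; positivity)
      (ENNReal.rpow_ne_top_of_nonneg (by norm_num) hN)
  have key : ∀ A : ℝ, S < A → eLpNorm (𝓕⁻ v) (ENNReal.ofReal q) volume ≤
      ENNReal.ofReal (C₀ ^ (1 / q) + 1) * ENNReal.ofReal A ^ θ * (N ^ (2⁻¹ : ℝ)) ^ (1 - θ) := by
    intro A hSA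
    have hA : 0 < A := hS0.trans_lt hSA
    have hmain := rs_main hq2 hγpos hγq χ hχmeas hχ01 hχ0 hχint hv hA
      (fun t ht => (le_ciSup hb ⟨t, ht⟩).trans hSA.le)
    rw [eLpNorm_eq_lintegral_rpow_enorm_toReal (by simpa using hq0) ENNReal.ofReal_ne_top,
      ENNReal.toReal_ofReal hq0.le]
    have e1 : ∫⁻ x, ‖𝓕⁻ v x‖ₑ ^ q = ∫⁻ x, ENNReal.ofReal (‖𝓕⁻ v x‖ ^ q) := by
      refine lintegral_congr fun x => ?_
      rw [← ofReal_norm, ENNReal.ofReal_rpow_of_nonneg (norm_nonneg _) hq0.le]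
    rw [e1]
    refine (ENNReal.rpow_le_rpow hmain (by positivity)).trans ?_
    rw [ENNReal.mul_rpow_of_nonneg _ _ (by positivity),
      ENNReal.ofReal_rpow_of_nonneg (by positivity) (by positivity),
      Real.mul_rpow hC₀nn (by positivity), ← Real.rpow_mul hA.le,
      show (q - 2) * (1 / q) = θ by rw [hθ]; field_simp,
      ENNReal.ofReal_mul (by positivity), ← ENNReal.ofReal_rpow_of_pos hA, ← ENNReal.rpow_mul,
      show 2⁻¹ * (1 - θ) = 1 / q by rw [hθ1]; field_simp]
    gcongr
    linarith
  have hlim : Tendsto (fun A : ℝ => ENNReal.ofReal (C₀ ^ (1 / q) + 1) * ENNReal.ofReal A ^ θ *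
      (N ^ (2⁻¹ : ℝ)) ^ (1 - θ)) (nhdsWithin S (Set.Ioi S))
      (nhds (ENNReal.ofReal (C₀ ^ (1 / q) + 1) * ENNReal.ofReal S ^ θ *
        (N ^ (2⁻¹ : ℝ)) ^ (1 - θ))) := by
    apply ENNReal.Tendsto.mul_const _ (Or.inr hM)
    apply ENNReal.Tendsto.const_mul _ (Or.inr ENNReal.ofReal_ne_top)
    apply Tendsto.ennrpow_const
    exact (ENNReal.continuous_ofReal.tendsto S).mono_left nhdsWithin_le_nhds
  refine ge_of_tendsto hlim ?_
  filter_upwards [self_mem_nhdsWithin] with A hA using key A hA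
end

section
/- Let $d \ge 1$. For every $a \in \mathcal{S}(\mathbb{R}^d)$ (Schwartz class) there exists $C > 0$ such that for all $u \in L^2(\mathbb{R}^d)$, $\int_{\mathbb{R}} \int_{\mathbb{R}^d} |a(x)| \, |(-\Delta_x)^{1/4} (e^{it\Delta} u)(x)|^2 \, dx \, dt \le C \|u\|_{L^2}^2$. -/
open MeasureTheory Filter
open scoped ENNReal NNReal FourierTransform
lemma ls_oneD (h : ℝ → ℝ≥0∞) (c : ℝ) :
    ∫⁻ r : ℝ, ENNReal.ofReal |r| * h (c - r ^ 2) ≤ ∫⁻ s, h s := by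
  have key : ∀ s : Set ℝ, MeasurableSet s → Set.InjOn (fun r : ℝ => c - r ^ 2) s →
      2 * ∫⁻ r in s, ENNReal.ofReal |r| * h (c - r ^ 2) ≤ ∫⁻ s, h s := by
    intro s hs hinj
    have := lintegral_image_eq_lintegral_abs_deriv_mul (f := fun r : ℝ => c - r ^ 2)
      (f' := fun r => - (2 * r)) hs
      (fun x _ => by
        have := ((hasDerivAt_pow 2 x).const_sub c).hasDerivWithinAt (s := s)
        simpa using this) hinj h
    rw [← lintegral_const_mul' _ _ (by norm_num)]
    calc _ = ∫⁻ x in s, ENNReal.ofReal |-(2 * x)| * h (c - x ^ 2) := by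
            congr 1; ext x
            rw [← mul_assoc, abs_neg, abs_mul, ENNReal.ofReal_mul (by positivity)]
            simp
      _ = _ := this.symm
      _ ≤ _ := setLIntegral_le_lintegral _ _
  have h1 := key (Set.Ici 0) measurableSet_Ici (by
    intro x hx y hy hxy
    simp only [Set.mem_Ici] at hx hy
    have : x ^ 2 = y ^ 2 := by simpa using hxy
    exact (pow_left_inj₀ hx hy two_ne_zero).1 this)
  have h2 := key (Set.Iio 0) measurableSet_Iio (by
    intro x hx y hy hxy
    simp only [Set.mem_Iio] at hx hy
    have : x ^ 2 = y ^ 2 := by simpa using hxy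
    nlinarith)
  rw [← lintegral_add_compl _ (measurableSet_Ici (a := (0:ℝ))), Set.compl_Ici]
  have h3 := add_le_add h1 h2
  rw [← mul_add, ← two_mul] at h3
  exact (ENNReal.mul_le_mul_iff_right (by norm_num) (by norm_num)).1 h3

lemma ls_gauss (n : ℕ) {β : ℝ} (hβ : 0 < β) (z : Fin n → ℝ) :
    ∫⁻ y : Fin n → ℝ, ENNReal.ofReal (Real.exp (-β * ∑ i, (z i - y i) ^ 2)) =
      ENNReal.ofReal ((Real.pi / β) ^ (n / 2 : ℝ)) := by
  have h1 := (PiLp.volume_preserving_ofLp (Fin n)).lintegral_comp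
    (f := fun y : Fin n → ℝ => ENNReal.ofReal (Real.exp (-β * ∑ i, (z i - y i) ^ 2)))
    (by fun_prop)
  rw [← h1]
  have h2 : ∀ y : EuclideanSpace ℝ (Fin n), ∑ i, (z i - y i) ^ 2 = ‖y - WithLp.toLp 2 z‖ ^ 2 := by
    intro y
    rw [EuclideanSpace.norm_sq_eq]
    simp [← sub_sq_comm]
  simp_rw [h2]
  rw [lintegral_sub_right_eq_self
    (fun y : EuclideanSpace ℝ (Fin n) => ENNReal.ofReal (Real.exp (-β * ‖y‖ ^ 2)))]
  have h3 := GaussianFourier.integral_rexp_neg_mul_sq_norm (V := EuclideanSpace ℝ (Fin n)) hβ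
  rw [← ofReal_integral_eq_lintegral_ofReal, h3]
  · simp
  · by_contra hc
    rw [integral_undef hc] at h3
    have : 0 < (Real.pi / β) ^ (Module.finrank ℝ (EuclideanSpace ℝ (Fin n)) / 2 : ℝ) := by positivity
    linarith
  · exact ae_of_all _ fun _ => by positivity

lemma ls_slice (n : ℕ) (j : Fin (n + 1)) {β : ℝ} (hβ : 0 < β) (h : ℝ → ℝ≥0∞) (hh : Measurable h)
    (c : ℝ) (ξ : EuclideanSpace ℝ (Fin (n + 1))) :
    ∫⁻ η : EuclideanSpace ℝ (Fin (n + 1)),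
      ENNReal.ofReal |η j| * (h (c - ‖η‖ ^ 2) * ENNReal.ofReal (Real.exp (-β * ‖ξ - η‖ ^ 2))) ≤
      (∫⁻ s, h s) * ENNReal.ofReal ((Real.pi / β) ^ (n / 2 : ℝ)) := by
  set G : ℝ × (Fin n → ℝ) → ℝ≥0∞ := fun p =>
    ENNReal.ofReal |p.1| * (h (c - (∑ i, (p.2 i) ^ 2) - p.1 ^ 2)) *
      ENNReal.ofReal (Real.exp (-β * ∑ i, (ξ (j.succAbove i) - p.2 i) ^ 2)) with hG
  have hGm : Measurable G := by fun_prop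
  calc _ ≤ ∫⁻ η : EuclideanSpace ℝ (Fin (n + 1)),
        G (MeasurableEquiv.piFinSuccAbove (fun _ => ℝ) j (WithLp.ofLp η)) := by
        refine lintegral_mono fun η => ?_
        rw [hG]
        simp only [MeasurableEquiv.piFinSuccAbove_apply]
        rw [← mul_assoc]
        have e1 : c - ‖η‖ ^ 2 = c - (∑ i, (η (j.succAbove i)) ^ 2) - η j ^ 2 := by
          rw [EuclideanSpace.norm_sq_eq, Fin.sum_univ_succAbove _ j]
          simp; ring
        have e2 : ∑ i, (ξ (j.succAbove i) - η (j.succAbove i)) ^ 2 ≤ ‖ξ - η‖ ^ 2 := by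
          rw [EuclideanSpace.norm_sq_eq, Fin.sum_univ_succAbove _ j]
          simp; positivity
        refine mul_le_mul' (by rw [e1]; exact le_of_eq rfl) (ENNReal.ofReal_le_ofReal (Real.exp_le_exp.2 ?_))
        have := mul_le_mul_of_nonneg_left e2 hβ.le
        simp only [neg_mul, neg_le_neg_iff]
        exact this
    _ = ∫⁻ p, G p := by
        rw [(PiLp.volume_preserving_ofLp (Fin (n + 1))).lintegral_comp
          (f := fun y => G (MeasurableEquiv.piFinSuccAbove (fun _ => ℝ) j y)) (by fun_prop)]
        exact (volume_preserving_piFinSuccAbove (fun _ => ℝ) j).lintegral_comp hGm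
    _ = ∫⁻ y : Fin n → ℝ, ∫⁻ r : ℝ, G (r, y) := by
        exact lintegral_prod_symm' _ hGm
    _ ≤ ∫⁻ y : Fin n → ℝ, (∫⁻ s, h s) *
          ENNReal.ofReal (Real.exp (-β * ∑ i, (ξ (j.succAbove i) - y i) ^ 2)) := by
        refine lintegral_mono fun y => ?_
        simp only [hG]
        rw [lintegral_mul_const' _ _ ENNReal.ofReal_ne_top]
        exact mul_le_mul' (ls_oneD h _) le_rfl
    _ = _ := by
        rw [lintegral_const_mul _ (by fun_prop), ls_gauss n hβ (fun i => ξ (j.succAbove i))]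

lemma ls_inner (n : ℕ) {β : ℝ} (hβ : 0 < β) (h : ℝ → ℝ≥0∞) (hh : Measurable h)
    (c : ℝ) (ξ : EuclideanSpace ℝ (Fin (n + 1))) :
    ∫⁻ η : EuclideanSpace ℝ (Fin (n + 1)),
      ENNReal.ofReal ‖η‖ * (h (c - ‖η‖ ^ 2) * ENNReal.ofReal (Real.exp (-β * ‖ξ - η‖ ^ 2))) ≤
      (n + 1 : ℕ) * ((∫⁻ s, h s) * ENNReal.ofReal ((Real.pi / β) ^ (n / 2 : ℝ))) := by
  calc _ ≤ ∫⁻ η : EuclideanSpace ℝ (Fin (n + 1)), ∑ j, ENNReal.ofReal |η j| *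
        (h (c - ‖η‖ ^ 2) * ENNReal.ofReal (Real.exp (-β * ‖ξ - η‖ ^ 2))) := by
        refine lintegral_mono fun η => ?_
        rw [← Finset.sum_mul]
        gcongr
        rw [← ENNReal.ofReal_sum_of_nonneg (fun _ _ => abs_nonneg _)]
        refine ENNReal.ofReal_le_ofReal ?_
        rw [EuclideanSpace.norm_eq]
        refine Real.sqrt_le_iff.2 ⟨by positivity, ?_⟩
        exact Finset.sum_sq_le_sq_sum_of_nonneg (fun i _ => abs_nonneg _)
    _ = ∑ j, ∫⁻ η : EuclideanSpace ℝ (Fin (n + 1)), ENNReal.ofReal |η j| *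
        (h (c - ‖η‖ ^ 2) * ENNReal.ofReal (Real.exp (-β * ‖ξ - η‖ ^ 2))) :=
        lintegral_finsetSum _ (fun j _ => by fun_prop)
    _ ≤ ∑ j : Fin (n + 1), (∫⁻ s, h s) * ENNReal.ofReal ((Real.pi / β) ^ (n / 2 : ℝ)) :=
        Finset.sum_le_sum fun j _ => ls_slice n j hβ h hh c ξ
    _ = _ := by simp

/-- Fubini expansion of a square. -/
lemma ls_fubini {X Y : Type*} [MeasurableSpace X] [MeasurableSpace Y] (μ : Measure Y)
    [IsFiniteMeasure μ] (ν : Measure X) [SFinite ν] (e : Y → X → ℂ)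
    (he : Measurable (Function.uncurry e)) (he1 : ∀ y x, ‖e y x‖ = 1) (w : X → ℂ)
    (hw : Integrable w ν) :
    ∫⁻ y, ‖∫ x, e y x * w x ∂ν‖ₑ ^ 2 ∂μ ≤
      ∫⁻ p : X × X, (‖w p.1‖ₑ * ‖w p.2‖ₑ) *
        ‖∫ y, e y p.1 * (starRingEnd ℂ) (e y p.2) ∂μ‖ₑ ∂(ν.prod ν) := by
  set F : Y → ℂ := fun y => ∫ x, e y x * w x ∂ν with hF
  have hjm : AEStronglyMeasurable (fun q : Y × X => e q.1 q.2 * w q.2) (μ.prod ν) :=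
    he.aestronglyMeasurable.mul hw.aestronglyMeasurable.comp_snd
  have hFm : AEStronglyMeasurable F μ := hjm.integral_prod_right'
  have hFb : ∀ y, ‖F y‖ ≤ ∫ x, ‖w x‖ ∂ν := fun y => by
    refine (norm_integral_le_integral_norm _).trans (le_of_eq ?_)
    simp [he1]
  have hconj : ∀ y, (starRingEnd ℂ) (F y) = ∫ x, (starRingEnd ℂ) (e y x * w x) ∂ν :=
    fun y => integral_conj.symm
  have hint : Integrable (fun y => F y * (starRingEnd ℂ) (F y)) μ := by
    refine Integrable.of_bound (C := (∫ x, ‖w x‖ ∂ν) ^ 2)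
      (hFm.mul (Complex.continuous_conj.comp_aestronglyMeasurable hFm)) (ae_of_all _ fun y => ?_)
    rw [norm_mul, RCLike.norm_conj, ← sq]
    exact pow_le_pow_left₀ (norm_nonneg _) (hFb y) 2
  have h1 : ∫⁻ y, ‖F y‖ₑ ^ 2 ∂μ = ‖∫ y, F y * (starRingEnd ℂ) (F y) ∂μ‖ₑ := by
    have e0 : ∀ y, F y * (starRingEnd ℂ) (F y) = ((‖F y‖ ^ 2 : ℝ) : ℂ) := fun y => by
      rw [Complex.mul_conj, Complex.normSq_eq_norm_sq]
    have hint' : Integrable (fun y => ‖F y‖ ^ 2) μ := by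
      have := hint.norm
      refine this.congr (ae_of_all _ fun y => ?_)
      simp [sq]
    simp_rw [e0]
    rw [integral_complex_ofReal, ← ofReal_norm, Complex.norm_real, ofReal_norm,
      Real.enorm_of_nonneg (integral_nonneg fun y => by positivity),
      ofReal_integral_eq_lintegral_ofReal hint' (ae_of_all _ fun y => by positivity)]
    congr 1; ext y
    rw [ENNReal.ofReal_pow (norm_nonneg _), ofReal_norm]
  have hwc : Integrable (fun p : X × X => w p.1 * (starRingEnd ℂ) (w p.2)) (ν.prod ν) := by
    refine Integrable.mul_prod (g := fun x => (starRingEnd ℂ) (w x)) hw ?_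
    exact (Complex.conjCLE.toContinuousLinearMap.integrable_comp hw)
  have hbig : Integrable (Function.uncurry fun (y : Y) (p : X × X) =>
      (e y p.1 * (starRingEnd ℂ) (e y p.2)) * (w p.1 * (starRingEnd ℂ) (w p.2)))
      (μ.prod (ν.prod ν)) := by
    have hb := (integrable_const (1:ℂ) (μ := μ)).mul_prod hwc
    refine hb.mono ?_ (ae_of_all _ fun q => ?_)
    · refine AEStronglyMeasurable.mul ?_ hwc.aestronglyMeasurable.comp_snd
      have m1 : Measurable fun q : Y × X × X => e q.1 q.2.1 :=
        he.comp (measurable_fst.prodMk measurable_snd.fst)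
      have m2 : Measurable fun q : Y × X × X => e q.1 q.2.2 :=
        he.comp (measurable_fst.prodMk measurable_snd.snd)
      exact (m1.mul (Complex.continuous_conj.measurable.comp m2)).aestronglyMeasurable
    · simp [Function.uncurry, he1]
  have h2 : ∫ y, F y * (starRingEnd ℂ) (F y) ∂μ =
      ∫ p : X × X, (w p.1 * (starRingEnd ℂ) (w p.2)) *
        (∫ y, e y p.1 * (starRingEnd ℂ) (e y p.2) ∂μ) ∂(ν.prod ν) := by
    calc _ = ∫ y, ∫ p : X × X, (e y p.1 * (starRingEnd ℂ) (e y p.2)) *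
          (w p.1 * (starRingEnd ℂ) (w p.2)) ∂(ν.prod ν) ∂μ := by
          congr 1; ext y
          rw [hconj, hF]
          simp only
          rw [← integral_prod_mul]
          congr 1; ext p
          simp only [map_mul]; ring
      _ = _ := by
          rw [integral_integral_swap hbig]
          congr 1; ext p
          rw [integral_mul_const, mul_comm]
  rw [h1, h2]
  refine (enorm_integral_le_lintegral_enorm _).trans (le_of_eq ?_)
  congr 1; ext p
  rw [enorm_mul, enorm_mul]
  congr 2
  simp [enorm]

lemma ls_schur {X : Type*} [MeasurableSpace X] (ν : Measure X) [SFinite ν]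
    (ρ : X → ℝ≥0∞) (hρ : Measurable ρ) (u w : X → ℝ≥0∞) (hu : Measurable u)
    (K : X × X → ℝ≥0∞) (hK : Measurable K) (hsymm : ∀ x y, K (x, y) = K (y, x)) (M : ℝ≥0∞)
    (hM : ∀ x, ∫⁻ y, ρ y * K (x, y) ∂ν ≤ M)
    (hamgm : ∀ x y, w x * w y ≤ 2⁻¹ * (ρ y * u x ^ 2) + 2⁻¹ * (ρ x * u y ^ 2)) :
    ∫⁻ p : X × X, w p.1 * w p.2 * K p ∂(ν.prod ν) ≤ M * ∫⁻ x, u x ^ 2 ∂ν := by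
  have hA : ∫⁻ p : X × X, (ρ p.2 * u p.1 ^ 2) * K p ∂(ν.prod ν) ≤ M * ∫⁻ x, u x ^ 2 ∂ν := by
    rw [lintegral_prod _ (by fun_prop), ← lintegral_const_mul _ (by fun_prop)]
    refine lintegral_mono fun x => ?_
    calc _ = ∫⁻ y, u x ^ 2 * (ρ y * K (x, y)) ∂ν := by congr 1; ext y; ring
      _ = u x ^ 2 * ∫⁻ y, (ρ y * K (x, y)) ∂ν := lintegral_const_mul _ (by fun_prop)
      _ ≤ u x ^ 2 * M := by gcongr; exact hM x
      _ = _ := mul_comm _ _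
  have hB : ∫⁻ p : X × X, (ρ p.1 * u p.2 ^ 2) * K p ∂(ν.prod ν) =
      ∫⁻ p : X × X, (ρ p.2 * u p.1 ^ 2) * K p ∂(ν.prod ν) := by
    rw [← lintegral_prod_swap]
    congr 1; ext p
    have := hsymm p.2 p.1
    simp only [Prod.swap, this]
  calc _ ≤ ∫⁻ p : X × X, (2⁻¹ * ((ρ p.2 * u p.1 ^ 2) * K p) +
        2⁻¹ * ((ρ p.1 * u p.2 ^ 2) * K p)) ∂(ν.prod ν) := by
        refine lintegral_mono fun p => ?_
        calc _ ≤ (2⁻¹ * (ρ p.2 * u p.1 ^ 2) + 2⁻¹ * (ρ p.1 * u p.2 ^ 2)) * K p := by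
              gcongr; exact hamgm _ _
          _ = _ := by ring
    _ = ∫⁻ p : X × X, (ρ p.2 * u p.1 ^ 2) * K p ∂(ν.prod ν) := by
        rw [lintegral_add_left (by fun_prop), lintegral_const_mul _ (by fun_prop),
          lintegral_const_mul _ (by fun_prop), hB, ← add_mul, ENNReal.inv_two_add_inv_two, one_mul]
    _ ≤ _ := hA

lemma ls_lint_h {ε : ℝ} (hε : 0 < ε) :
    ∫⁻ c : ℝ, ENNReal.ofReal (Real.sqrt (Real.pi / ε) * Real.exp (-c ^ 2 / (4 * ε))) =
      ENNReal.ofReal (2 * Real.pi) := by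
  have e0 : ∀ c : ℝ, -c ^ 2 / (4 * ε) = -(1 / (4 * ε)) * c ^ 2 := fun c => by ring
  simp_rw [e0]
  rw [← ofReal_integral_eq_lintegral_ofReal
    ((integrable_exp_neg_mul_sq (by positivity)).const_mul _)
    (ae_of_all _ fun _ => by positivity), integral_const_mul, integral_gaussian,
    ← Real.sqrt_mul (by positivity)]
  congr 1
  rw [show Real.pi / ε * (Real.pi / (1 / (4 * ε))) = (2 * Real.pi) ^ 2 by field_simp; ring]
  exact Real.sqrt_sq (by positivity)

lemma ls_kt {ε : ℝ} (hε : 0 < ε) (c : ℝ) :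
    ‖∫ t : ℝ, (Real.exp (-ε * t ^ 2) : ℂ) * Complex.exp (((-(t * c) : ℝ) : ℂ) * Complex.I)‖ₑ =
      ENNReal.ofReal (Real.sqrt (Real.pi / ε) * Real.exp (-c ^ 2 / (4 * ε))) := by
  have h := fourierIntegral_gaussian (b := (ε : ℂ)) (by simpa using hε) (-(c : ℂ))
  have e1 : ∫ t : ℝ, (Real.exp (-ε * t ^ 2) : ℂ) * Complex.exp (((-(t * c) : ℝ) : ℂ) * Complex.I) =
      ∫ x : ℝ, Complex.exp (Complex.I * (-(c : ℂ)) * x) * Complex.exp (-(ε : ℂ) * x ^ 2) := by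
    congr 1; ext t
    rw [mul_comm]
    push_cast
    congr 2; ring
  rw [e1, h]
  have e2 : ((Real.pi : ℂ) / ε) ^ (1 / 2 : ℂ) = ((Real.sqrt (Real.pi / ε) : ℝ) : ℂ) := by
    rw [Real.sqrt_eq_rpow, Complex.ofReal_cpow (by positivity)]
    push_cast; rfl
  have e3 : Complex.exp (-(-(c:ℂ)) ^ 2 / (4 * ε)) = ((Real.exp (-c ^ 2 / (4 * ε)) : ℝ) : ℂ) := by
    push_cast; congr 2; ring
  rw [e2, e3, ← Complex.ofReal_mul, ← ofReal_norm, Complex.norm_real,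
    Real.norm_of_nonneg (by positivity)]

lemma ls_kx (d : ℕ) {σ : ℝ} (hσ : 0 < σ) (z : EuclideanSpace ℝ (Fin d)) :
    ‖∫ x : EuclideanSpace ℝ (Fin d), (Real.exp (-σ * ‖x‖ ^ 2) : ℂ) *
      Complex.exp (((2 * Real.pi * inner ℝ z x : ℝ) : ℂ) * Complex.I)‖ₑ =
      ENNReal.ofReal ((Real.pi / σ) ^ (d / 2 : ℝ)) *
        ENNReal.ofReal (Real.exp (-(Real.pi ^ 2 / σ) * ‖z‖ ^ 2)) := by
  have h := GaussianFourier.integral_cexp_neg_mul_sq_norm_add (b := (σ : ℂ)) (by simpa using hσ)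
    (2 * Real.pi * Complex.I) z
  have e1 : ∫ x : EuclideanSpace ℝ (Fin d), (Real.exp (-σ * ‖x‖ ^ 2) : ℂ) *
      Complex.exp (((2 * Real.pi * inner ℝ z x : ℝ) : ℂ) * Complex.I) =
      ∫ v : EuclideanSpace ℝ (Fin d), Complex.exp (-(σ:ℂ) * (‖v‖ : ℂ) ^ 2 +
        2 * Real.pi * Complex.I * ((inner ℝ z v : ℝ) : ℂ)) := by
    congr 1; ext x
    rw [Complex.exp_add]
    push_cast
    congr 2; ring
  rw [e1, h]
  have e2 : ((Real.pi : ℂ) / σ) ^ (Module.finrank ℝ (EuclideanSpace ℝ (Fin d)) / 2 : ℂ) =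
      (((Real.pi / σ) ^ (d / 2 : ℝ) : ℝ) : ℂ) := by
    rw [Complex.ofReal_cpow (by positivity)]
    simp
  have e3 : Complex.exp ((2 * Real.pi * Complex.I) ^ 2 * (‖z‖ : ℂ) ^ 2 / (4 * σ)) =
      ((Real.exp (-(Real.pi ^ 2 / σ) * ‖z‖ ^ 2) : ℝ) : ℂ) := by
    push_cast; congr 1
    rw [mul_pow, Complex.I_sq]; ring
  rw [e2, e3, ← Complex.ofReal_mul, ← ofReal_norm, Complex.norm_real,
    Real.norm_of_nonneg (by positivity), ENNReal.ofReal_mul (by positivity)]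

/-- the phase -/
noncomputable def lsPhase (d : ℕ) (p : ℝ × EuclideanSpace ℝ (Fin d))
    (ξ : EuclideanSpace ℝ (Fin d)) : ℂ :=
  Complex.exp (((2 * Real.pi * inner ℝ ξ p.2 - p.1 * ‖ξ‖ ^ 2 : ℝ) : ℂ) * Complex.I)

lemma lsPhase_norm (d p ξ) : ‖lsPhase d p ξ‖ = 1 := Complex.norm_exp_ofReal_mul_I _

lemma lsPhase_cont (d) : Continuous (Function.uncurry (lsPhase d)) := by
  unfold lsPhase Function.uncurry
  fun_prop

lemma ls_finite {X : Type*} [MeasurableSpace X] (ν : Measure X) (f : X → ℝ) (hf : Integrable f ν) :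
    IsFiniteMeasure (ν.withDensity fun x => ENNReal.ofReal (f x)) :=
  isFiniteMeasure_withDensity_ofReal hf.2

lemma ls_gint (d : ℕ) {σ : ℝ} (hσ : 0 < σ) :
    Integrable fun x : EuclideanSpace ℝ (Fin d) => Real.exp (-σ * ‖x‖ ^ 2) := by
  by_contra hc
  have h3 := GaussianFourier.integral_rexp_neg_mul_sq_norm (V := EuclideanSpace ℝ (Fin d)) hσ
  rw [integral_undef hc] at h3
  have : 0 < (Real.pi / σ) ^ (Module.finrank ℝ (EuclideanSpace ℝ (Fin d)) / 2 : ℝ) := by positivity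
  linarith

/-- solution -/
noncomputable def lsF (d : ℕ) (w : EuclideanSpace ℝ (Fin d) → ℂ)
    (p : ℝ × EuclideanSpace ℝ (Fin d)) : ℂ := ∫ ξ, lsPhase d p ξ * w ξ

lemma lsF_cont (d) (w) (hw : Integrable w) : Continuous (lsF d w) := by
  unfold lsF
  refine continuous_of_dominated (bound := fun ξ => ‖w ξ‖) (fun p => ?_)
    (fun p => ae_of_all _ fun ξ => ?_) hw.norm (ae_of_all _ fun ξ => ?_)
  · refine AEStronglyMeasurable.mul ?_ hw.1
    exact ((lsPhase_cont d).comp (Continuous.prodMk_right p)).aestronglyMeasurable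
  · simp [lsPhase_norm]
  · exact ((lsPhase_cont d).comp (Continuous.prodMk_left ξ)).mul continuous_const

lemma ls_gw (n : ℕ) {ε σ : ℝ} (hε : 0 < ε) (hσ : 0 < σ) (v : EuclideanSpace ℝ (Fin (n+1)) → ℂ)
    (hv : Measurable v)
    (hw : Integrable fun ξ : EuclideanSpace ℝ (Fin (n+1)) => ((‖ξ‖ ^ (2⁻¹ : ℝ) : ℝ) : ℂ) * v ξ) :
    ∫⁻ t : ℝ, ENNReal.ofReal (Real.exp (-ε * t ^ 2)) * ∫⁻ x : EuclideanSpace ℝ (Fin (n+1)),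
      ENNReal.ofReal (Real.exp (-σ * ‖x‖ ^ 2)) *
      ‖lsF (n+1) (fun ξ => ((‖ξ‖ ^ (2⁻¹ : ℝ) : ℝ) : ℂ) * v ξ) (t, x)‖ₑ ^ 2 ≤
    (((n + 1 : ℕ) * (ENNReal.ofReal (2 * Real.pi) *
        ENNReal.ofReal ((Real.pi / (Real.pi ^ 2 / σ)) ^ (n / 2 : ℝ)))) *
      ENNReal.ofReal ((Real.pi / σ) ^ ((n + 1 : ℕ) / 2 : ℝ))) * ∫⁻ ξ, ‖v ξ‖ₑ ^ 2 := by
  set w : EuclideanSpace ℝ (Fin (n+1)) → ℂ := fun ξ => ((‖ξ‖ ^ (2⁻¹ : ℝ) : ℝ) : ℂ) * v ξ with hwdef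
  set m1 : Measure ℝ := volume.withDensity fun t => ENNReal.ofReal (Real.exp (-ε * t ^ 2)) with hm1
  set m2 : Measure (EuclideanSpace ℝ (Fin (n+1))) :=
    volume.withDensity fun x => ENNReal.ofReal (Real.exp (-σ * ‖x‖ ^ 2)) with hm2
  have : IsFiniteMeasure m1 := ls_finite _ _ (integrable_exp_neg_mul_sq hε)
  have : IsFiniteMeasure m2 := ls_finite _ _ (ls_gint _ hσ)
  have hFm : Measurable (lsF (n+1) w) := (lsF_cont _ _ hw).measurable
  have hL : ∫⁻ t : ℝ, ENNReal.ofReal (Real.exp (-ε * t ^ 2)) *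
      ∫⁻ x : EuclideanSpace ℝ (Fin (n+1)), ENNReal.ofReal (Real.exp (-σ * ‖x‖ ^ 2)) *
      ‖lsF (n+1) w (t, x)‖ₑ ^ 2 = ∫⁻ p, ‖lsF (n+1) w p‖ₑ ^ 2 ∂(m1.prod m2) := by
    rw [lintegral_prod _ (by fun_prop), hm1, lintegral_withDensity_eq_lintegral_mul _ (by fun_prop)
      (Measurable.lintegral_prod_right' (f := fun p => ‖lsF (n+1) w p‖ₑ ^ 2) (by fun_prop))]
    congr 1; ext t
    simp only [Pi.mul_apply]
    rw [hm2, lintegral_withDensity_eq_lintegral_mul _ (by fun_prop) (by fun_prop)]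
    rfl
  set h : ℝ → ℝ≥0∞ := fun c =>
    ENNReal.ofReal (Real.sqrt (Real.pi / ε) * Real.exp (-c ^ 2 / (4 * ε))) with hh
  set A := ENNReal.ofReal ((Real.pi / σ) ^ ((n + 1 : ℕ) / 2 : ℝ)) with hA
  set K : EuclideanSpace ℝ (Fin (n+1)) × EuclideanSpace ℝ (Fin (n+1)) → ℝ≥0∞ := fun p =>
    h (‖p.1‖ ^ 2 - ‖p.2‖ ^ 2) * (A *
      ENNReal.ofReal (Real.exp (-(Real.pi ^ 2 / σ) * ‖p.1 - p.2‖ ^ 2))) with hK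
  have hhm : Measurable h := by fun_prop
  have hKeq : ∀ p : EuclideanSpace ℝ (Fin (n+1)) × EuclideanSpace ℝ (Fin (n+1)),
      ‖∫ y, lsPhase (n+1) y p.1 * (starRingEnd ℂ) (lsPhase (n+1) y p.2) ∂(m1.prod m2)‖ₑ = K p := by
    intro p
    have e0 : ∀ y : ℝ × EuclideanSpace ℝ (Fin (n+1)),
        lsPhase (n+1) y p.1 * (starRingEnd ℂ) (lsPhase (n+1) y p.2) =
        Complex.exp (((-(y.1 * (‖p.1‖ ^ 2 - ‖p.2‖ ^ 2)) : ℝ) : ℂ) * Complex.I) *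
        Complex.exp (((2 * Real.pi * inner ℝ (p.1 - p.2) y.2 : ℝ) : ℂ) * Complex.I) := by
      intro y
      unfold lsPhase
      rw [← Complex.exp_conj, ← Complex.exp_add, ← Complex.exp_add, inner_sub_left]
      congr 1
      simp only [map_mul, Complex.conj_ofReal, Complex.conj_I]
      push_cast; ring
    simp_rw [e0]
    rw [integral_prod_mul
      (fun t : ℝ => Complex.exp (((-(t * (‖p.1‖ ^ 2 - ‖p.2‖ ^ 2)) : ℝ) : ℂ) * Complex.I))
      (fun x => Complex.exp (((2 * Real.pi * inner ℝ (p.1 - p.2) x : ℝ) : ℂ) * Complex.I)),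
      enorm_mul, hm1, hm2,
      integral_withDensity_eq_integral_toReal_smul (by fun_prop) (ae_of_all _ fun _ => by simp),
      integral_withDensity_eq_integral_toReal_smul (by fun_prop) (ae_of_all _ fun _ => by simp)]
    simp only [ENNReal.toReal_ofReal (Real.exp_nonneg _), Complex.real_smul]
    rw [ls_kt hε, ls_kx _ hσ]
  rw [hL]
  refine (ls_fubini (m1.prod m2) volume (lsPhase (n+1)) (lsPhase_cont _).measurable
    (lsPhase_norm _) w hw).trans ?_
  simp_rw [hKeq]
  refine ls_schur volume (fun ξ => ENNReal.ofReal ‖ξ‖) (by fun_prop) (fun ξ => ‖v ξ‖ₑ)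
    (fun ξ => ‖w ξ‖ₑ) (by fun_prop) K (by fun_prop) ?_ _ ?_ ?_
  · intro x y
    simp only [hK, hh]
    rw [norm_sub_rev x y, show ‖y‖ ^ 2 - ‖x‖ ^ 2 = - (‖x‖ ^ 2 - ‖y‖ ^ 2) by ring, neg_sq]
  · intro ξ
    have := ls_inner n (β := Real.pi ^ 2 / σ) (by positivity) h hhm (‖ξ‖ ^ 2) ξ
    rw [ls_lint_h hε] at this
    refine le_trans (le_of_eq ?_) (mul_le_mul' this (le_refl A))
    rw [← lintegral_mul_const _ (by fun_prop)]
    congr 1; ext η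
    simp only [hK]; ring
  · intro x y
    have hr : ∀ z, ‖w z‖ₑ = ENNReal.ofReal (Real.sqrt ‖z‖ * ‖v z‖) := by
      intro z
      rw [← ofReal_norm, hwdef, norm_mul, Complex.norm_real,
        Real.norm_of_nonneg (by positivity), Real.sqrt_eq_rpow]
      norm_num
    have h2 : (2⁻¹ : ℝ≥0∞) = ENNReal.ofReal 2⁻¹ := by
      rw [ENNReal.ofReal_inv_of_pos (by norm_num)]; simp
    simp only [hr, ← ofReal_norm (v _)]
    rw [h2, ← ENNReal.ofReal_pow (norm_nonneg _), ← ENNReal.ofReal_pow (norm_nonneg _),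
      ← ENNReal.ofReal_mul (by positivity), ← ENNReal.ofReal_mul (by positivity),
      ← ENNReal.ofReal_mul (by positivity), ← ENNReal.ofReal_mul (by positivity),
      ← ENNReal.ofReal_mul (by positivity), ← ENNReal.ofReal_add (by positivity) (by positivity)]
    refine ENNReal.ofReal_le_ofReal ?_
    have hx := Real.sq_sqrt (norm_nonneg x)
    have hy := Real.sq_sqrt (norm_nonneg y)
    nlinarith [sq_nonneg (Real.sqrt ‖y‖ * ‖v x‖ - Real.sqrt ‖x‖ * ‖v y‖)]

lemma ls_gw2 (n : ℕ) {σ : ℝ} (hσ : 0 < σ) (v : EuclideanSpace ℝ (Fin (n+1)) → ℂ)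
    (hv : Measurable v)
    (hw : Integrable fun ξ : EuclideanSpace ℝ (Fin (n+1)) => ((‖ξ‖ ^ (2⁻¹ : ℝ) : ℝ) : ℂ) * v ξ) :
    ∫⁻ t : ℝ, ∫⁻ x : EuclideanSpace ℝ (Fin (n+1)),
      ENNReal.ofReal (Real.exp (-σ * ‖x‖ ^ 2)) *
      ‖lsF (n+1) (fun ξ => ((‖ξ‖ ^ (2⁻¹ : ℝ) : ℝ) : ℂ) * v ξ) (t, x)‖ₑ ^ 2 ≤
    (((n + 1 : ℕ) * (ENNReal.ofReal (2 * Real.pi) *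
        ENNReal.ofReal ((Real.pi / (Real.pi ^ 2 / σ)) ^ (n / 2 : ℝ)))) *
      ENNReal.ofReal ((Real.pi / σ) ^ ((n + 1 : ℕ) / 2 : ℝ))) * ∫⁻ ξ, ‖v ξ‖ₑ ^ 2 := by
  set Φ : ℝ → ℝ≥0∞ := fun t => ∫⁻ x : EuclideanSpace ℝ (Fin (n+1)),
      ENNReal.ofReal (Real.exp (-σ * ‖x‖ ^ 2)) *
      ‖lsF (n+1) (fun ξ => ((‖ξ‖ ^ (2⁻¹ : ℝ) : ℝ) : ℂ) * v ξ) (t, x)‖ₑ ^ 2 with hΦ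
  have hFm := (lsF_cont _ _ hw).measurable
  have hΦm : Measurable Φ := Measurable.lintegral_prod_right'
    (f := fun p : ℝ × EuclideanSpace ℝ (Fin (n+1)) => ENNReal.ofReal (Real.exp (-σ * ‖p.2‖ ^ 2)) *
      ‖lsF (n+1) (fun ξ => ((‖ξ‖ ^ (2⁻¹ : ℝ) : ℝ) : ℂ) * v ξ) p‖ₑ ^ 2) (by fun_prop)
  have hlim : ∀ t, Tendsto (fun k : ℕ =>
      ENNReal.ofReal (Real.exp (-(1 / ((k : ℝ) + 1)) * t ^ 2)) * Φ t) atTop (nhds (Φ t)) := by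
    intro t
    have h1 : Tendsto (fun k : ℕ => Real.exp (-(1 / ((k : ℝ) + 1)) * t ^ 2)) atTop (nhds 1) := by
      have := (tendsto_one_div_add_atTop_nhds_zero_nat (𝕜 := ℝ)).neg.mul_const (t ^ 2)
      have := (Real.continuous_exp.tendsto _).comp this
      simpa [Function.comp_def] using this
    have h2 := ENNReal.Tendsto.mul_const (b := Φ t) (ENNReal.tendsto_ofReal h1) (Or.inl (by simp))
    simpa using h2
  calc ∫⁻ t, Φ t = ∫⁻ t, liminf (fun k : ℕ =>
        ENNReal.ofReal (Real.exp (-(1 / ((k : ℝ) + 1)) * t ^ 2)) * Φ t) atTop := by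
        congr 1; ext t; exact (hlim t).liminf_eq.symm
    _ ≤ liminf (fun k : ℕ => ∫⁻ t,
        ENNReal.ofReal (Real.exp (-(1 / ((k : ℝ) + 1)) * t ^ 2)) * Φ t) atTop :=
        lintegral_liminf_le fun k => by fun_prop
    _ ≤ liminf (fun _ : ℕ => (((n + 1 : ℕ) * (ENNReal.ofReal (2 * Real.pi) *
        ENNReal.ofReal ((Real.pi / (Real.pi ^ 2 / σ)) ^ (n / 2 : ℝ)))) *
      ENNReal.ofReal ((Real.pi / σ) ^ ((n + 1 : ℕ) / 2 : ℝ))) * ∫⁻ ξ, ‖v ξ‖ₑ ^ 2) atTop :=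
        liminf_le_liminf (Eventually.of_forall fun k => ls_gw n (by positivity) hσ v hv hw)
    _ = _ := liminf_const _

lemma ls_const (n k : ℕ) :
    (((n + 1 : ℕ) * (ENNReal.ofReal (2 * Real.pi) *
        ENNReal.ofReal ((Real.pi / (Real.pi ^ 2 / ((1/4 : ℝ) ^ k))) ^ (n / 2 : ℝ)))) *
      ENNReal.ofReal ((Real.pi / ((1/4 : ℝ) ^ k)) ^ ((n + 1 : ℕ) / 2 : ℝ))) ≤
    ENNReal.ofReal (((n + 1 : ℕ) * (2 * Real.pi) * Real.pi ^ ((n + 1 : ℕ) / 2 : ℝ)) *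
      2 ^ (k * (n + 1))) := by
  have h1 : (Real.pi / (Real.pi ^ 2 / ((1/4 : ℝ) ^ k))) ^ (n / 2 : ℝ) ≤ 1 := by
    refine Real.rpow_le_one (by positivity) ?_ (by positivity)
    have h4 : (1/4 : ℝ) ^ k ≤ 1 := pow_le_one₀ (by norm_num) (by norm_num)
    rw [show Real.pi / (Real.pi ^ 2 / ((1/4 : ℝ) ^ k)) = (1/4 : ℝ) ^ k / Real.pi by field_simp]
    rw [div_le_one Real.pi_pos]
    linarith [Real.pi_gt_three]
  have h2 : (Real.pi / ((1/4 : ℝ) ^ k)) ^ ((n + 1 : ℕ) / 2 : ℝ) =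
      Real.pi ^ ((n + 1 : ℕ) / 2 : ℝ) * 2 ^ (k * (n + 1)) := by
    rw [show Real.pi / ((1/4 : ℝ) ^ k) = Real.pi * ((2 : ℝ) ^ k) ^ (2 : ℝ) by
      rw [one_div, inv_pow, div_inv_eq_mul]
      norm_cast
      rw [← pow_mul, mul_comm k 2, pow_mul]; norm_num]
    rw [Real.mul_rpow (by positivity) (by positivity), ← Real.rpow_mul (by positivity),
      mul_div_cancel₀ _ (by norm_num : (2:ℝ) ≠ 0), Real.rpow_natCast, pow_mul]
  rw [h2, ← ENNReal.ofReal_natCast (n + 1), ← ENNReal.ofReal_mul (by positivity),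
    ← ENNReal.ofReal_mul (by positivity), ← ENNReal.ofReal_mul (by positivity)]
  refine ENNReal.ofReal_le_ofReal ?_
  rw [mul_assoc _ (Real.pi ^ ((n + 1 : ℕ) / 2 : ℝ))]
  refine mul_le_mul_of_nonneg_right ?_ (by positivity)
  refine mul_le_mul_of_nonneg_left ?_ (by positivity)
  exact mul_le_of_le_one_right (by positivity) h1

lemma ls_dom (n : ℕ) (a : SchwartzMap (EuclideanSpace ℝ (Fin (n+1))) ℝ) :
    ∃ A > (0:ℝ), ∀ x, (‖a x‖₊ : ℝ≥0∞) ≤ ∑' k : ℕ, ENNReal.ofReal (A * (1/2) ^ (k * (n + 2))) *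
      ENNReal.ofReal (Real.exp (-((1/4 : ℝ) ^ k) * ‖x‖ ^ 2)) := by
  obtain ⟨C0, hC0, h0⟩ := a.decay 0 0
  obtain ⟨C1, hC1, h1⟩ := a.decay (n + 2) 0
  simp only [pow_zero, one_mul, norm_iteratedFDeriv_zero] at h0 h1
  refine ⟨Real.exp 1 * (C0 + C1 * 2 ^ (n + 2)), by positivity, fun x => ?_⟩
  have key : ∃ k : ℕ, ‖a x‖ ≤ (C0 + C1 * 2 ^ (n + 2)) * (1/2) ^ (k * (n + 2)) ∧ ‖x‖ ≤ 2 ^ k := by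
    by_cases hx : ‖x‖ ≤ 1
    · exact ⟨0, by simpa using (h0 x).trans (le_add_of_nonneg_right (by positivity)), by simpa using hx⟩
    · push Not at hx
      obtain ⟨k, hk1, hk2⟩ := exists_nat_pow_near hx.le (by norm_num : (1:ℝ) < 2)
      refine ⟨k + 1, ?_, hk2.le⟩
      have h3 : (2:ℝ) ^ (k * (n + 2)) * ‖a x‖ ≤ C1 := by
        refine le_trans ?_ (h1 x)
        rw [pow_mul]
        gcongr
      have h4 : ‖a x‖ ≤ C1 * (1/2) ^ (k * (n + 2)) := by
        rw [one_div, inv_pow, ← div_eq_mul_inv, le_div_iff₀ (by positivity)]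
        linarith
      have h5 : C1 * (1/2 : ℝ) ^ (k * (n + 2)) =
          C1 * 2 ^ (n + 2) * (1/2) ^ ((k + 1) * (n + 2)) := by
        rw [add_mul, one_mul, pow_add, one_div, inv_pow, inv_pow]; field_simp; ring
      rw [h5] at h4
      refine h4.trans ?_
      gcongr
      linarith
  obtain ⟨k, hk, hxk⟩ := key
  refine le_trans ?_ (ENNReal.le_tsum k)
  rw [← ENNReal.ofReal_mul (by positivity)]
  change ‖a x‖ₑ ≤ _
  rw [← ofReal_norm]
  refine ENNReal.ofReal_le_ofReal ?_
  have he : Real.exp (-1) ≤ Real.exp (-((1/4 : ℝ) ^ k) * ‖x‖ ^ 2) := by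
    refine Real.exp_le_exp.2 ?_
    have : ‖x‖ ^ 2 ≤ 4 ^ k := by
      calc ‖x‖ ^ 2 ≤ (2 ^ k) ^ 2 := by gcongr
        _ = 4 ^ k := by rw [← pow_mul, mul_comm, pow_mul]; norm_num
    have : (1/4 : ℝ) ^ k * ‖x‖ ^ 2 ≤ (1/4 : ℝ) ^ k * 4 ^ k := by gcongr
    rw [← mul_pow] at this
    norm_num at this ⊢
    linarith
  calc ‖a x‖ ≤ (C0 + C1 * 2 ^ (n + 2)) * (1/2) ^ (k * (n + 2)) := hk
    _ = (Real.exp 1 * (C0 + C1 * 2 ^ (n + 2)) * (1/2) ^ (k * (n + 2))) * Real.exp (-1) := by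
        rw [Real.exp_neg]; field_simp
    _ ≤ _ := by gcongr

lemma ls_main (n : ℕ) (a : SchwartzMap (EuclideanSpace ℝ (Fin (n+1))) ℝ) :
    ∃ C > (0 : ℝ), ∀ v : EuclideanSpace ℝ (Fin (n+1)) → ℂ, Measurable v →
      (Integrable fun ξ : EuclideanSpace ℝ (Fin (n+1)) => ((‖ξ‖ ^ (2⁻¹ : ℝ) : ℝ) : ℂ) * v ξ) →
    ∫⁻ t : ℝ, ∫⁻ x : EuclideanSpace ℝ (Fin (n+1)), (‖a x‖₊ : ℝ≥0∞) *
      ‖lsF (n+1) (fun ξ => ((‖ξ‖ ^ (2⁻¹ : ℝ) : ℝ) : ℂ) * v ξ) (t, x)‖ₑ ^ 2 ≤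
    ENNReal.ofReal C * ∫⁻ ξ, ‖v ξ‖ₑ ^ 2 := by
  obtain ⟨A, hA, hdom⟩ := ls_dom n a
  set B : ℝ := ((n + 1 : ℕ) * (2 * Real.pi) * Real.pi ^ ((n + 1 : ℕ) / 2 : ℝ)) with hB
  have hBpos : 0 < B := by positivity
  refine ⟨A * B * 2, by positivity, fun v hv hw => ?_⟩
  set F := lsF (n+1) (fun ξ => ((‖ξ‖ ^ (2⁻¹ : ℝ) : ℝ) : ℂ) * v ξ) with hF
  have hFm : Measurable F := (lsF_cont _ _ hw).measurable
  calc _ ≤ ∫⁻ t : ℝ, ∫⁻ x : EuclideanSpace ℝ (Fin (n+1)), ∑' k : ℕ,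
        ENNReal.ofReal (A * (1/2) ^ (k * (n + 2))) *
        (ENNReal.ofReal (Real.exp (-((1/4 : ℝ) ^ k) * ‖x‖ ^ 2)) * ‖F (t, x)‖ₑ ^ 2) := by
        refine lintegral_mono fun t => lintegral_mono fun x => ?_
        simp_rw [← mul_assoc]
        rw [ENNReal.tsum_mul_right]
        exact mul_le_mul' (hdom x) le_rfl
    _ = ∑' k : ℕ, ENNReal.ofReal (A * (1/2) ^ (k * (n + 2))) *
        ∫⁻ t : ℝ, ∫⁻ x : EuclideanSpace ℝ (Fin (n+1)),
        (ENNReal.ofReal (Real.exp (-((1/4 : ℝ) ^ k) * ‖x‖ ^ 2)) * ‖F (t, x)‖ₑ ^ 2) := by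
        have hm : ∀ k : ℕ, Measurable fun t : ℝ => ∫⁻ x : EuclideanSpace ℝ (Fin (n+1)),
            (ENNReal.ofReal (Real.exp (-((1/4 : ℝ) ^ k) * ‖x‖ ^ 2)) * ‖F (t, x)‖ₑ ^ 2) := fun k =>
          Measurable.lintegral_prod_right' (f := fun p : ℝ × EuclideanSpace ℝ (Fin (n+1)) =>
            ENNReal.ofReal (Real.exp (-((1/4 : ℝ) ^ k) * ‖p.2‖ ^ 2)) * ‖F p‖ₑ ^ 2) (by fun_prop)
        have e1 : ∀ t : ℝ, ∫⁻ x : EuclideanSpace ℝ (Fin (n+1)), ∑' k : ℕ,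
            ENNReal.ofReal (A * (1/2) ^ (k * (n + 2))) *
            (ENNReal.ofReal (Real.exp (-((1/4 : ℝ) ^ k) * ‖x‖ ^ 2)) * ‖F (t, x)‖ₑ ^ 2) =
            ∑' k : ℕ, ENNReal.ofReal (A * (1/2) ^ (k * (n + 2))) *
            ∫⁻ x : EuclideanSpace ℝ (Fin (n+1)),
            (ENNReal.ofReal (Real.exp (-((1/4 : ℝ) ^ k) * ‖x‖ ^ 2)) * ‖F (t, x)‖ₑ ^ 2) := by
          intro t
          rw [lintegral_tsum (fun k => by fun_prop)]
          congr 1; ext k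
          rw [lintegral_const_mul _ (by fun_prop)]
        simp_rw [e1]
        rw [lintegral_tsum (fun k => ((hm k).const_mul _).aemeasurable)]
        congr 1; ext k
        rw [lintegral_const_mul _ (hm k)]
    _ ≤ ∑' k : ℕ, ENNReal.ofReal (A * (1/2) ^ (k * (n + 2))) *
        (ENNReal.ofReal (B * 2 ^ (k * (n + 1))) * ∫⁻ ξ, ‖v ξ‖ₑ ^ 2) := by
        refine ENNReal.tsum_le_tsum fun k => ?_
        refine mul_le_mul' le_rfl ?_
        exact (ls_gw2 n (by positivity) v hv hw).trans (mul_le_mul' (ls_const n k) le_rfl)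
    _ = (∑' k : ℕ, ENNReal.ofReal (A * B * (1/2) ^ k)) * ∫⁻ ξ, ‖v ξ‖ₑ ^ 2 := by
        rw [← ENNReal.tsum_mul_right]
        congr 1; ext k
        rw [← mul_assoc, ← ENNReal.ofReal_mul (by positivity)]
        congr 2
        rw [show k * (n + 2) = k * (n + 1) + k by ring, pow_add]
        simp only [one_div, inv_pow]
        field_simp
    _ = _ := by
        congr 1
        rw [← ENNReal.ofReal_tsum_of_nonneg (fun k => by positivity)
          (summable_geometric_two.mul_left _), tsum_mul_left, tsum_geometric_two]

theorem local_smoothing_schrodinger (d : ℕ) (hd : 1 ≤ d)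
    (a : SchwartzMap (EuclideanSpace ℝ (Fin d)) ℝ) :
    ∃ C > (0 : ℝ), ∀ v : EuclideanSpace ℝ (Fin d) → ℂ,
      (∫⁻ t : ℝ, ∫⁻ x : EuclideanSpace ℝ (Fin d),
          (‖a x‖₊ : ℝ≥0∞) *
            (‖𝓕⁻ (fun ξ : EuclideanSpace ℝ (Fin d) =>
              ((‖ξ‖ ^ (2⁻¹ : ℝ) : ℝ) : ℂ) *
                Complex.exp (-Complex.I * (t : ℂ) * ((‖ξ‖ ^ 2 : ℝ) : ℂ)) * v ξ) x‖₊
              : ℝ≥0∞) ^ 2) ≤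
        ENNReal.ofReal C *
          ∫⁻ ξ : EuclideanSpace ℝ (Fin d), (‖v ξ‖₊ : ℝ≥0∞) ^ 2 := by
  obtain ⟨n, rfl⟩ : ∃ n, d = n + 1 := ⟨d - 1, by omega⟩
  obtain ⟨C, hC, hmain⟩ := ls_main n a
  refine ⟨C, hC, fun v => ?_⟩
  have hFI : ∀ (t : ℝ) (x : EuclideanSpace ℝ (Fin (n+1))),
      𝓕⁻ (fun ξ : EuclideanSpace ℝ (Fin (n+1)) => ((‖ξ‖ ^ (2⁻¹ : ℝ) : ℝ) : ℂ) *
        Complex.exp (-Complex.I * (t : ℂ) * ((‖ξ‖ ^ 2 : ℝ) : ℂ)) * v ξ) x =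
      lsF (n+1) (fun ξ => ((‖ξ‖ ^ (2⁻¹ : ℝ) : ℝ) : ℂ) * v ξ) (t, x) := by
    intro t x
    rw [Real.fourierInv_eq', lsF]
    congr 1; ext ξ
    rw [smul_eq_mul, lsPhase]
    have : Complex.exp (((2 * Real.pi * inner ℝ ξ x - t * ‖ξ‖ ^ 2 : ℝ) : ℂ) * Complex.I) =
        Complex.exp (((2 * Real.pi * inner ℝ ξ x : ℝ) : ℂ) * Complex.I) *
          Complex.exp (-Complex.I * (t : ℂ) * ((‖ξ‖ ^ 2 : ℝ) : ℂ)) := by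
      rw [← Complex.exp_add]; congr 1; push_cast; ring
    simp only [this]
    ring
  simp_rw [hFI]
  by_cases hw : Integrable fun ξ : EuclideanSpace ℝ (Fin (n+1)) =>
      ((‖ξ‖ ^ (2⁻¹ : ℝ) : ℝ) : ℂ) * v ξ
  · have hvm : AEMeasurable v := by
      have h1 : AEMeasurable fun ξ : EuclideanSpace ℝ (Fin (n+1)) =>
          (((‖ξ‖ ^ (2⁻¹ : ℝ) : ℝ) : ℂ))⁻¹ * (((‖ξ‖ ^ (2⁻¹ : ℝ) : ℝ) : ℂ) * v ξ) := by
        refine AEMeasurable.mul (Measurable.aemeasurable (by fun_prop)) hw.1.aemeasurable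
      refine h1.congr ?_
      have h0 : ∀ᵐ ξ : EuclideanSpace ℝ (Fin (n+1)), ξ ≠ 0 := by
        simp [ae_iff]
      filter_upwards [h0] with ξ hξ
      refine inv_mul_cancel_left₀ ?_ _
      have : 0 < ‖ξ‖ := norm_pos_iff.2 hξ
      exact_mod_cast (by positivity : (0:ℝ) < ‖ξ‖ ^ (2⁻¹ : ℝ)).ne'
    have hae : v =ᵐ[volume] hvm.mk v := hvm.ae_eq_mk
    have hwae : (fun ξ : EuclideanSpace ℝ (Fin (n+1)) => ((‖ξ‖ ^ (2⁻¹ : ℝ) : ℝ) : ℂ) * v ξ)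
        =ᵐ[volume] fun ξ => ((‖ξ‖ ^ (2⁻¹ : ℝ) : ℝ) : ℂ) * hvm.mk v ξ := by
      filter_upwards [hae] with ξ hξ
      rw [hξ]
    have hm := hmain (hvm.mk v) hvm.measurable_mk (hw.congr hwae)
    have e1 : lsF (n+1) (fun ξ => ((‖ξ‖ ^ (2⁻¹ : ℝ) : ℝ) : ℂ) * v ξ) =
        lsF (n+1) (fun ξ => ((‖ξ‖ ^ (2⁻¹ : ℝ) : ℝ) : ℂ) * hvm.mk v ξ) := by
      ext p
      unfold lsF
      refine integral_congr_ae ?_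
      filter_upwards [hwae] with ξ hξ
      simp only [hξ]
    have e2 : ∫⁻ ξ, (‖v ξ‖₊ : ℝ≥0∞) ^ 2 = ∫⁻ ξ, ‖hvm.mk v ξ‖ₑ ^ 2 := by
      refine lintegral_congr_ae ?_
      filter_upwards [hae] with ξ hξ
      rw [hξ]; rfl
    rw [e1, e2]
    exact hm
  · have hz : ∀ p, lsF (n+1) (fun ξ => ((‖ξ‖ ^ (2⁻¹ : ℝ) : ℝ) : ℂ) * v ξ) p = 0 := by
      intro p
      refine integral_undef fun hi => hw ?_
      have hc : Continuous fun ξ => (lsPhase (n+1) p ξ)⁻¹ :=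
        ((lsPhase_cont _).comp (Continuous.prodMk_right p)).inv₀ fun ξ h => by
          have := lsPhase_norm (n+1) p ξ
          have h' : lsPhase (n+1) p ξ = 0 := h
          rw [h'] at this; simp at this
      have := hi.bdd_mul (c := 1) hc.aestronglyMeasurable
        (ae_of_all _ fun ξ => by simp [lsPhase_norm])
      refine this.congr (ae_of_all _ fun ξ => ?_)
      refine inv_mul_cancel_left₀ (fun h => ?_) _
      have := lsPhase_norm (n+1) p ξ
      rw [h] at this; simp at this
    simp [hz]
end
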